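/- arXiv:1203.3569 — 6 statements merged into one kernel-verified Lean document; each statement's English description precedes it below -/
import Mathlib

section
/- Let H(t,q,p) : ℝ × ℝ^d × ℝ^d → ℝ be a C² Hamiltonian, Ω ⊂ ℝ × ℝ^d an open set, and u(t,q) : Ω → ℝ a function which is differentiable with locally Lipschitz differential and solves the Hamilton–Jacobi equation ∂_t u + H(t, q, ∂_q u(t,q)) = 0 on Ω. Let q(t) : [t₀,t₁] → ℝ^d be a C¹ curve such that (t, q(t)) ∈ Ω and q̇(t) = ∂_p H(t, q(t), ∂_q u(t, q(t))) for each t ∈ [t₀,t₁]. Then, setting p(t) = ∂_q u(t, q(t)), the curve t ↦ p(t) is C¹ and (q(t), p(t)) solves the Hamiltonian system (HS) on [t₀,t₁]. -/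
open scoped RealInnerProductSpace NNReal
open Set Metric

open Filter Topology

section

variable {E : Type*} [NormedAddCommGroup E] [InnerProductSpace ℝ E]

/-- Along the straight line through `(t, x)` with velocity `v = ∂ₚH(t, x, G (t, x))`, the momentum
field `G` of a solution of the Hamilton–Jacobi equation has derivative `-∂_q H`. -/
theorem hasDerivAt_momentum_line {H : ℝ × E × E → ℝ} {u : ℝ × E → ℝ} {G : ℝ × E → E}
    {t : ℝ} {x v k : E} {U : Set (ℝ × E)} {K : ℝ≥0} {L : ℝ × E × E →L[ℝ] ℝ}
    (hU : U ∈ 𝓝 (t, x))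
    (hu : ∀ z ∈ U, HasFDerivAt u ((-H (z.1, z.2, G z)) • ContinuousLinearMap.fst ℝ ℝ E +
      (innerSL ℝ (G z)).comp (ContinuousLinearMap.snd ℝ ℝ E)) z)
    (hG : LipschitzOnWith K G U)
    (hH : HasStrictFDerivAt H L (t, x, G (t, x)))
    (hL : ∀ a b, L (0, a, b) = ⟪k, a⟫ + ⟪v, b⟫) :
    HasDerivAt (fun τ => G (τ, x + (τ - t) • v)) (-k) t := by
  rw [hasDerivAt_iff_isLittleO, Asymptotics.isLittleO_iff]
  intro ε hε
  have hGc : ContinuousAt G (t, x) := hG.continuousOn.continuousAt hU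
  have hc1 : Tendsto (fun y : ℝ × E => (y.1, x + (y.1 - t) • v + y.2)) (𝓝 (t, 0)) (𝓝 (t, x)) := by
    have : Continuous (fun y : ℝ × E => (y.1, x + (y.1 - t) • v + y.2)) := by fun_prop
    simpa using this.tendsto (t, 0)
  have hc0 : Tendsto (fun y : ℝ × E => (y.1, x + (y.1 - t) • v)) (𝓝 (t, 0)) (𝓝 (t, x)) := by
    have : Continuous (fun y : ℝ × E => (y.1, x + (y.1 - t) • v)) := by fun_prop
    simpa using this.tendsto (t, 0)
  have hpair : ∀ f : ℝ × E → ℝ × E, Tendsto f (𝓝 (t, 0)) (𝓝 (t, x)) →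
      Tendsto (fun y => ((f y).1, (f y).2, G (f y))) (𝓝 (t, 0)) (𝓝 (t, x, G (t, x))) := by
    intro f hf
    exact (continuous_fst.continuousAt.tendsto.comp hf).prodMk_nhds
      ((continuous_snd.continuousAt.tendsto.comp hf).prodMk_nhds (hGc.tendsto.comp hf))
  have hε' : 0 < ε / (1 + K) := by positivity
  have hstrict := ((hpair _ hc1).prodMk_nhds (hpair _ hc0)).eventually
    (hH.isLittleO.def hε')
  obtain ⟨δ, hδ, hball⟩ := Metric.eventually_nhds_iff_ball.1
    (hstrict.and ((hc1.eventually hU).and (hc0.eventually hU)))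
  have hder : ∀ τ w, τ ∈ ball t δ → ‖w‖ < δ →
      ∃ D, HasDerivAt (fun τ => u (τ, x + (τ - t) • v + w) - u (τ, x + (τ - t) • v) + τ * ⟪k, w⟫)
        D τ ∧ ‖D‖ ≤ ε * ‖w‖ := by
    intro τ w hτ hw
    obtain ⟨h1, h2, h3⟩ := hball (τ, w) (by
      simpa [Prod.dist_eq] using ⟨hτ, hw⟩)
    have hline : HasDerivAt (fun τ : ℝ => x + (τ - t) • v) v τ := by
      simpa using (((hasDerivAt_id τ).sub_const t).smul_const v).const_add x
    have d1 := (hu _ h2).comp_hasDerivAt τ ((hasDerivAt_id τ).prodMk (hline.add_const w))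
    have d0 := (hu _ h3).comp_hasDerivAt τ ((hasDerivAt_id τ).prodMk hline)
    refine ⟨_, (d1.sub d0).add ((hasDerivAt_id τ).mul_const ⟪k, w⟫), ?_⟩
    dsimp only at h1 h2 h3 ⊢
    set G1 := G (τ, x + (τ - t) • v + w)
    set G0 := G (τ, x + (τ - t) • v)
    have hG10 : ‖G1 - G0‖ ≤ K * ‖w‖ := by
      have := hG.dist_le_mul _ h2 _ h3
      simpa [dist_eq_norm, Prod.norm_def, G1, G0] using this
    have e1 : (τ, x + (τ - t) • v + w, G1) - (τ, x + (τ - t) • v, G0) = (0, w, G1 - G0) := by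
      simp
    rw [e1, hL] at h1
    have hn : ‖((0 : ℝ), w, G1 - G0)‖ ≤ (1 + K) * ‖w‖ := by
      have hK : (0 : ℝ) ≤ K := K.2
      have := norm_nonneg w
      simp only [Prod.norm_def, norm_zero]
      refine max_le (by positivity) (max_le ?_ ?_) <;> nlinarith [mul_nonneg hK this]
    calc _ = ‖H (τ, x + (τ - t) • v + w, G1) - H (τ, x + (τ - t) • v, G0)
            - (⟪k, w⟫ + ⟪v, G1 - G0⟫)‖ := by
          rw [← norm_neg]
          congr 1
          simp only [add_apply, smul_apply,
            ContinuousLinearMap.comp_apply, ContinuousLinearMap.coe_fst',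
            ContinuousLinearMap.coe_snd', innerSL_apply_apply, inner_sub_right, smul_eq_mul,
            real_inner_comm v]
          ring
      _ ≤ ε / (1 + K) * ((1 + K) * ‖w‖) := h1.trans (by gcongr)
      _ = ε * ‖w‖ := by field_simp
  filter_upwards [Metric.ball_mem_nhds t hδ] with b hb
  have hxU : ∀ y ∈ ball t δ, (y, x + (y - t) • v) ∈ U := fun y hy =>
    (hball (y, 0) (by simpa [Prod.dist_eq, hδ] using hy)).2.2
  have hfd : ∀ y ∈ ball t δ, HasFDerivAt (fun w => u (y, x + (y - t) • v + w))
      (innerSL ℝ (G (y, x + (y - t) • v))) 0 := by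
    intro y hy
    have h := hu (y, x + (y - t) • v + 0) (by simpa only [add_zero] using hxU y hy)
    have h2 : HasFDerivAt (fun w : E => (y, x + (y - t) • v + w))
        ((0 : E →L[ℝ] ℝ).prod (ContinuousLinearMap.id ℝ E)) 0 :=
      (hasFDerivAt_const y 0).prodMk ((hasFDerivAt_id (0 : E)).const_add _)
    refine (h.comp (0 : E) h2).congr_fderiv ?_
    ext w
    simp
  have ht : t ∈ ball t δ := mem_ball_self hδ
  have hmain := ((hfd b hb).sub (hfd t ht)).add ((b - t) • innerSL ℝ k).hasFDerivAt
  have hle := hmain.le_of_lip' (C := ε * ‖b - t‖) (by positivity) (by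
    filter_upwards [Metric.ball_mem_nhds (0 : E) hδ] with w hw
    have hw' : ‖w‖ < δ := by simpa using hw
    choose! D hD hDn using fun τ hτ => hder τ w hτ hw'
    have := (convex_ball t δ).norm_image_sub_le_of_norm_hasDerivWithin_le
      (fun τ hτ => (hD τ hτ).hasDerivWithinAt) hDn ht hb
    simp only [Pi.add_apply, Pi.sub_apply, smul_apply, innerSL_apply_apply, inner_zero_right,
      smul_eq_mul, sub_zero, add_zero, mul_zero, sub_self, zero_smul] at this ⊢
    calc _ = _ := by congr 1; ring
      _ ≤ _ := this
      _ = _ := by ring)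
  rw [← map_sub, ← map_smul, ← map_add, innerSL_apply_norm] at hle
  simpa [sub_neg_eq_add] using hle

/-- Along any curve through `(t, x)` with velocity `v = ∂ₚH(t, x, G (t, x))`, the momentum
field `G` of a solution of the Hamilton–Jacobi equation has derivative `-∂_q H`. -/
theorem hasDerivAt_momentum_curve {H : ℝ × E × E → ℝ} {u : ℝ × E → ℝ} {G : ℝ × E → E}
    {t : ℝ} {q : ℝ → E} {v k : E} {U : Set (ℝ × E)} {K : ℝ≥0} {L : ℝ × E × E →L[ℝ] ℝ}
    (hU : U ∈ 𝓝 (t, q t))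
    (hu : ∀ z ∈ U, HasFDerivAt u ((-H (z.1, z.2, G z)) • ContinuousLinearMap.fst ℝ ℝ E +
      (innerSL ℝ (G z)).comp (ContinuousLinearMap.snd ℝ ℝ E)) z)
    (hG : LipschitzOnWith K G U)
    (hH : HasStrictFDerivAt H L (t, q t, G (t, q t)))
    (hL : ∀ a b, L (0, a, b) = ⟪k, a⟫ + ⟪v, b⟫) (hq : HasDerivAt q v t) :
    HasDerivAt (fun τ => G (τ, q τ)) (-k) t := by
  have hline := hasDerivAt_momentum_line hU hu hG hH hL
  rw [hasDerivAt_iff_isLittleO] at hline hq ⊢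
  have hqc : Tendsto (fun τ => (τ, q τ)) (𝓝 t) (𝓝 (t, q t)) :=
    tendsto_id.prodMk_nhds (hasDerivAt_iff_isLittleO.2 hq).continuousAt.tendsto
  have hlc : Tendsto (fun τ => (τ, q t + (τ - t) • v)) (𝓝 t) (𝓝 (t, q t)) := by
    have : Continuous (fun τ => (τ, q t + (τ - t) • v)) := by fun_prop
    simpa using this.tendsto t
  have hO : (fun τ => G (τ, q τ) - G (τ, q t + (τ - t) • v)) =O[𝓝 t]
      fun τ => q τ - q t - (τ - t) • v := by
    refine Asymptotics.IsBigO.of_bound K ?_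
    filter_upwards [hqc.eventually hU, hlc.eventually hU] with τ h1 h2
    simpa [dist_eq_norm, Prod.norm_def, sub_sub] using hG.dist_le_mul _ h1 _ h2
  refine ((hO.trans_isLittleO hq).add hline).congr_left fun τ => ?_
  simp only [sub_self, zero_smul, add_zero]
  abel

theorem hasFDerivAt_snd_slice {u : ℝ × E → ℝ} {A : ℝ × E →L[ℝ] ℝ} {z : ℝ × E}
    (h : HasFDerivAt u A z) :
    HasFDerivAt (fun y => u (z.1, y)) (A.comp (ContinuousLinearMap.inr ℝ ℝ E)) z.2 :=
  HasFDerivAt.comp (g := u) (f := fun y => (z.1, y)) z.2 h (hasFDerivAt_prodMk_right z.1 z.2)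

theorem hasFDerivAt_position_slice {H : ℝ × E × E → ℝ} {L : ℝ × E × E →L[ℝ] ℝ} {t : ℝ} {x p : E}
    (h : HasFDerivAt H L (t, x, p)) :
    HasFDerivAt (fun y => H (t, y, p))
      (L.comp ((ContinuousLinearMap.inr ℝ ℝ (E × E)).comp (ContinuousLinearMap.inl ℝ E E))) x :=
  HasFDerivAt.comp (g := H) (f := fun y => (t, y, p)) x h
    ((hasFDerivAt_prodMk_right t (x, p)).comp x (hasFDerivAt_prodMk_left x p))

theorem hasFDerivAt_momentum_slice {H : ℝ × E × E → ℝ} {L : ℝ × E × E →L[ℝ] ℝ} {t : ℝ} {x p : E}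
    (h : HasFDerivAt H L (t, x, p)) :
    HasFDerivAt (fun y => H (t, x, y))
      (L.comp ((ContinuousLinearMap.inr ℝ ℝ (E × E)).comp (ContinuousLinearMap.inr ℝ E E))) p :=
  HasFDerivAt.comp (g := H) (f := fun y => (t, x, y)) p h
    ((hasFDerivAt_prodMk_right t (x, p)).comp p (hasFDerivAt_prodMk_right x p))

variable [CompleteSpace E]

theorem inner_gradient_of_hasFDerivAt {f : E → ℝ} {x : E} {f' : E →L[ℝ] ℝ} (h : HasFDerivAt f f' x) (w : E) :
    ⟪gradient f x, w⟫ = f' w := by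
  rw [gradient, h.fderiv, InnerProductSpace.toDual_symm_apply]

theorem lipschitzOnWith_gradient_snd {u : ℝ × E → ℝ} {U : Set (ℝ × E)} {K : ℝ≥0}
    (hu : ∀ z ∈ U, DifferentiableAt ℝ u z) (hK : LipschitzOnWith K (fun z => fderiv ℝ u z) U) :
    LipschitzOnWith K (fun z : ℝ × E => gradient (fun y => u (z.1, y)) z.2) U := by
  refine LipschitzOnWith.of_dist_le_mul fun z hz w hw => ?_
  refine le_trans ?_ (hK.dist_le_mul z hz w hw)
  simp only [gradient, (hasFDerivAt_snd_slice (hu z hz).hasFDerivAt).fderiv,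
    (hasFDerivAt_snd_slice (hu w hw).hasFDerivAt).fderiv, LinearIsometryEquiv.dist_map]
  rw [dist_eq_norm, dist_eq_norm, ← ContinuousLinearMap.sub_comp]
  exact (ContinuousLinearMap.opNorm_comp_le _ _).trans
    (mul_le_of_le_one_right (norm_nonneg _) (ContinuousLinearMap.norm_inr_le_one ℝ ℝ E))

theorem hasFDerivAt_of_hamiltonJacobi {u : ℝ × E → ℝ} {z : ℝ × E} {h : ℝ}
    (hu : DifferentiableAt ℝ u z) (hHJ : deriv (fun τ => u (τ, z.2)) z.1 + h = 0) :
    HasFDerivAt u ((-h) • ContinuousLinearMap.fst ℝ ℝ E +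
      (innerSL ℝ (gradient (fun y => u (z.1, y)) z.2)).comp
        (ContinuousLinearMap.snd ℝ ℝ E)) z := by
  refine hu.hasFDerivAt.congr_fderiv ?_
  have ht : HasDerivAt (fun τ => u (τ, z.2)) (fderiv ℝ u z (1, 0)) z.1 :=
    HasFDerivAt.comp_hasDerivAt (l := u) (f := fun τ => (τ, z.2)) z.1 hu.hasFDerivAt
      ((hasDerivAt_id z.1).prodMk (hasDerivAt_const z.1 z.2))
  rw [ht.deriv] at hHJ
  refine ContinuousLinearMap.prod_ext ?_ ?_
  · ext
    simp
    linarith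
  · ext w
    simp [inner_gradient_of_hasFDerivAt (hasFDerivAt_snd_slice hu.hasFDerivAt)]

theorem continuous_gradient_position {H : ℝ × E × E → ℝ} (hH : ContDiff ℝ 1 H) :
    Continuous fun y : ℝ × E × E => gradient (fun q' => H (y.1, q', y.2.2)) y.2.1 := by
  have : ∀ y : ℝ × E × E, fderiv ℝ (fun q' => H (y.1, q', y.2.2)) y.2.1 =
      (fderiv ℝ H y).comp
        ((ContinuousLinearMap.inr ℝ ℝ (E × E)).comp (ContinuousLinearMap.inl ℝ E E)) := fun y =>
    (hasFDerivAt_position_slice (hH.differentiable one_ne_zero y).hasFDerivAt).fderiv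
  simp only [gradient, this]
  exact (InnerProductSpace.toDual ℝ E).symm.continuous.comp
    ((hH.continuous_fderiv one_ne_zero).clm_comp continuous_const)

end

/-- If `u` is a `C^{1,1}_loc` solution of the Hamilton–Jacobi equation on an
open set `Ω`, and `q(t)` is a `C¹` curve in `Ω` satisfying
`q̇(t) = ∂ₚH(t, q(t), ∂_q u(t, q(t)))`, then `p(t) := ∂_q u(t, q(t))` is `C¹` and `(q, p)`
solves the Hamiltonian system on `[t₀, t₁]`. -/
theorem characteristics_of_C11_solutions {d : ℕ}
    (H : ℝ → EuclideanSpace ℝ (Fin d) → EuclideanSpace ℝ (Fin d) → ℝ)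
    (hH : ContDiff ℝ 2 (fun x : ℝ × EuclideanSpace ℝ (Fin d) × EuclideanSpace ℝ (Fin d) =>
      H x.1 x.2.1 x.2.2))
    (Ω : Set (ℝ × EuclideanSpace ℝ (Fin d))) (hΩ : IsOpen Ω)
    (u : ℝ × EuclideanSpace ℝ (Fin d) → ℝ)
    -- `u` is differentiable on `Ω` ...
    (hu_diff : ∀ z ∈ Ω, DifferentiableAt ℝ u z)
    -- ... with locally Lipschitz differential
    (hu_lip : ∀ z ∈ Ω, ∃ ε > 0, ball z ε ⊆ Ω ∧
      ∃ K : ℝ≥0, LipschitzOnWith K (fun w => fderiv ℝ u w) (ball z ε))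
    -- `u` solves the Hamilton–Jacobi equation on `Ω`
    (hu_HJ : ∀ z ∈ Ω, deriv (fun τ => u (τ, z.2)) z.1 +
      H z.1 z.2 (gradient (fun y => u (z.1, y)) z.2) = 0)
    (t₀ t₁ : ℝ) (ht : t₀ ≤ t₁)
    (q : ℝ → EuclideanSpace ℝ (Fin d))
    (hq_mem : ∀ t ∈ Icc t₀ t₁, (t, q t) ∈ Ω)
    (hq_ode : ∀ t ∈ Icc t₀ t₁,
      HasDerivAt q
        (gradient (fun p' => H t (q t) p') (gradient (fun y => u (t, y)) (q t))) t) :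
    ContDiffOn ℝ 1 (fun t => gradient (fun y => u (t, y)) (q t)) (Icc t₀ t₁) ∧
    ∀ t ∈ Icc t₀ t₁,
      HasDerivAt q
        (gradient (fun p' => H t (q t) p')
          (gradient (fun y => u (t, y)) (q t))) t ∧
      HasDerivAt (fun τ => gradient (fun y => u (τ, y)) (q τ))
        (-gradient (fun q' => H t q' (gradient (fun y => u (t, y)) (q t))) (q t)) t := by
  have hH1 := hH.of_le (m := 1) (by norm_num)
  have key : ∀ t ∈ Icc t₀ t₁, HasDerivAt (fun τ => gradient (fun y => u (τ, y)) (q τ))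
      (-gradient (fun q' => H t q' (gradient (fun y => u (t, y)) (q t))) (q t)) t := by
    intro t ht
    obtain ⟨ε, hε, hsub, K, hK⟩ := hu_lip _ (hq_mem t ht)
    have hs := hH1.contDiffAt.hasStrictFDerivAt (x := (t, q t, gradient (fun y => u (t, y)) (q t)))
      one_ne_zero
    refine hasDerivAt_momentum_curve
      (H := fun x : ℝ × EuclideanSpace ℝ (Fin d) × EuclideanSpace ℝ (Fin d) => H x.1 x.2.1 x.2.2)
      (G := fun z => gradient (fun y => u (z.1, y)) z.2) (Metric.ball_mem_nhds _ hε)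
      (fun z hz => hasFDerivAt_of_hamiltonJacobi (hu_diff z (hsub hz)) (hu_HJ z (hsub hz)))
      (lipschitzOnWith_gradient_snd (fun z hz => hu_diff z (hsub hz)) hK) hs (fun a b => ?_)
      (hq_ode t ht)
    rw [inner_gradient_of_hasFDerivAt (hasFDerivAt_position_slice hs.hasFDerivAt),
      inner_gradient_of_hasFDerivAt (hasFDerivAt_momentum_slice hs.hasFDerivAt)]
    simp [← map_add]
  refine ⟨?_, fun t ht => ⟨hq_ode t ht, key t ht⟩⟩
  rcases ht.eq_or_lt with rfl | hlt
  · refine (contDiffOn_const (c := gradient (fun y => u (t₀, y)) (q t₀))).congr fun t ht => ?_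
    rw [Icc_self, mem_singleton_iff] at ht
    rw [ht]
  have hud := uniqueDiffOn_Icc hlt
  rw [show (1 : WithTop ℕ∞) = 0 + 1 by norm_num, contDiffOn_succ_iff_derivWithin hud]
  refine ⟨fun t ht => (key t ht).differentiableAt.differentiableWithinAt, by simp, ?_⟩
  rw [contDiffOn_zero]
  have hcq : ContinuousOn q (Icc t₀ t₁) := fun t ht => (hq_ode t ht).continuousAt.continuousWithinAt
  have hcp : ContinuousOn (fun τ => gradient (fun y => u (τ, y)) (q τ)) (Icc t₀ t₁) := fun t ht =>
    (key t ht).continuousAt.continuousWithinAt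
  refine ContinuousOn.congr ?_ fun t ht => (key t ht).hasDerivWithinAt.derivWithin (hud t ht)
  exact ((continuous_gradient_position hH1).comp_continuousOn
    (continuousOn_id.prodMk (hcq.prodMk hcp))).neg
end

section
/- Let H(t,q,p) : ℝ × ℝ^d × ℝ^d → ℝ be a C² Hamiltonian whose Hamiltonian system (HS) is complete, i.e. every maximal solution is defined on all of ℝ. Let u(t,q) : (t₀,t₁) × ℝ^d → ℝ be a C^{1,1}_loc solution of the Hamilton–Jacobi equation (HJ). Then for every s ∈ (t₀,t₁) and every point (q_s, p_s) with p_s = ∂_q u(s, q_s), there exists a solution (q(t), p(t)) : (t₀,t₁) → ℝ^d × ℝ^d of (HS) such that (q(s), p(s)) = (q_s, p_s) and p(t) = ∂_q u(t, q(t)) for every t ∈ (t₀,t₁). Consequently, the graphs Γ_t := {(q, ∂_q u(t,q)) : q ∈ ℝ^d} satisfy Γ_t = φ_s^t(Γ_s) for all s, t ∈ (t₀,t₁), where φ_s^t is the flow of (HS) from time s to time t. -/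
open scoped RealInnerProductSpace NNReal
open Set Metric Filter Topology Asymptotics InnerProductSpace

section Lipschitz

variable {α β γ : Type*} [PseudoEMetricSpace α] [PseudoEMetricSpace β] [PseudoEMetricSpace γ]

/-- `f` is Lipschitz on some neighbourhood of `x`. -/
def LipschitzNear (f : α → β) (x : α) : Prop :=
  ∃ K : ℝ≥0, ∃ U ∈ 𝓝 x, LipschitzOnWith K f U

lemma LipschitzNear.continuousAt {f : α → β} {x : α} (hf : LipschitzNear f x) :
    ContinuousAt f x := by
  obtain ⟨K, U, hU, h⟩ := hf
  exact h.continuousOn.continuousAt hU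

lemma LipschitzNear.eventually_nhds {f : α → β} {x : α} (hf : LipschitzNear f x) :
    ∀ᶠ y in 𝓝 x, LipschitzNear f y := by
  obtain ⟨K, U, hU, h⟩ := hf
  exact (eventually_mem_nhds_iff.2 hU).mono fun y hy => ⟨K, U, hy, h⟩

lemma LipschitzWith.lipschitzNear {f : α → β} {K : ℝ≥0} (hf : LipschitzWith K f) (x : α) :
    LipschitzNear f x :=
  ⟨K, univ, univ_mem, hf.lipschitzOnWith⟩

lemma LipschitzNear.comp {g : β → γ} {f : α → β} {x : α} (hg : LipschitzNear g (f x))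
    (hf : LipschitzNear f x) : LipschitzNear (fun y => g (f y)) x := by
  have hfc := hf.continuousAt
  obtain ⟨K, U, hU, h⟩ := hf
  obtain ⟨L, V, hV, h'⟩ := hg
  exact ⟨L * K, U ∩ f ⁻¹' V, inter_mem hU (hfc hV),
    h'.comp (h.mono inter_subset_left) fun y hy => hy.2⟩

lemma LipschitzNear.prodMk {f : α → β} {g : α → γ} {x : α} (hf : LipschitzNear f x)
    (hg : LipschitzNear g x) : LipschitzNear (fun y => (f y, g y)) x := by
  obtain ⟨K, U, hU, h⟩ := hf
  obtain ⟨L, V, hV, h'⟩ := hg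
  exact ⟨max K L, U ∩ V, inter_mem hU hV,
    (h.mono inter_subset_left).prodMk (h'.mono inter_subset_right)⟩

end Lipschitz

section ODE

variable {E : Type*} [NormedAddCommGroup E] [NormedSpace ℝ E]

/-- Local existence for a time-dependent vector field that is jointly Lipschitz near the initial
point. -/
lemma LipschitzNear.exists_eventually_hasDerivAt [CompleteSpace E] {V : ℝ × E → E} {τ : ℝ} {x : E}
    (hV : LipschitzNear V (τ, x)) :
    ∃ q : ℝ → E, q τ = x ∧ ∀ᶠ t in 𝓝 τ, HasDerivAt q (V (t, q t)) t := by
  obtain ⟨K, U, hU, hK⟩ := hV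
  obtain ⟨ε, hε, hεU⟩ := nhds_basis_closedBall.mem_iff.1 hU
  rw [← closedBall_prod_same] at hεU
  lift ε to ℝ≥0 using hε.le
  set M : ℝ≥0 := ‖V (τ, x)‖₊ + K * ε with hM
  set δ : ℝ := min ε (ε / (M + 1))
  have hε' : (0 : ℝ) < ε := hε
  have hδ0 : 0 < δ := lt_min hε' (by positivity)
  have hIcc : Icc (τ - δ) (τ + δ) ⊆ closedBall τ ε := by
    rw [← Real.closedBall_eq_Icc]
    exact closedBall_subset_closedBall (min_le_left _ _)
  have hmem : ∀ t ∈ Icc (τ - δ) (τ + δ), ∀ y ∈ closedBall x (ε : ℝ), (t, y) ∈ U :=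
    fun t ht y hy => hεU ⟨hIcc ht, hy⟩
  have hpl : IsPicardLindelof (fun t y => V (t, y))
      (⟨τ, by constructor <;> linarith⟩ : Icc (τ - δ) (τ + δ)) x ε 0 M K := by
    refine ⟨fun t ht => ?_, fun y hy => ?_, fun t ht y hy => ?_, ?_⟩
    · have := hK.comp ((LipschitzWith.prodMk_left t).lipschitzOnWith (s := closedBall x (ε : ℝ)))
        fun y hy => hmem t ht y hy
      simpa [Function.comp_def] using this
    · exact hK.continuousOn.comp (by fun_prop) fun t ht => hmem t ht y hy
    · have h1 := hK.norm_sub_le (hmem t ht y hy) (mem_of_mem_nhds hU)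
      have h2 : ‖(t, y) - (τ, x)‖ ≤ ε := by
        rw [← dist_eq_norm, Prod.dist_eq]
        exact max_le (hIcc ht) hy
      have h3 : (K : ℝ) * ‖(t, y) - (τ, x)‖ ≤ K * ε := by gcongr
      have h4 := norm_le_norm_add_norm_sub' (V (t, y)) (V (τ, x))
      rw [hM]
      push_cast
      linarith
    · have h1 : δ ≤ ε / (M + 1) := min_le_right _ _
      have h2 : (0 : ℝ) < M + 1 := by positivity
      rw [le_div_iff₀ h2] at h1
      simp only [add_sub_cancel_left, sub_sub_cancel, max_self, NNReal.coe_zero, sub_zero]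
      nlinarith
  obtain ⟨q, hq, hq'⟩ := hpl.exists_eq_forall_mem_Icc_hasDerivWithinAt₀
  refine ⟨q, hq, ?_⟩
  filter_upwards [Ioo_mem_nhds (sub_lt_self τ hδ0) (lt_add_of_pos_right τ hδ0)] with t ht
  exact (hq' t (Ioo_subset_Icc_self ht)).hasDerivAt (Icc_mem_nhds ht.1 ht.2)

/-- Local uniqueness for a time-dependent vector field that is jointly Lipschitz near the initial
point. -/
lemma LipschitzNear.eventuallyEq_of_hasDerivAt {V : ℝ × E → E} {τ : ℝ} {f g : ℝ → E}
    (hV : LipschitzNear V (τ, f τ))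
    (hf : ∀ᶠ t in 𝓝 τ, HasDerivAt f (V (t, f t)) t)
    (hg : ∀ᶠ t in 𝓝 τ, HasDerivAt g (V (t, g t)) t) (h : f τ = g τ) : f =ᶠ[𝓝 τ] g := by
  obtain ⟨K, U, hU, hK⟩ := hV
  have hgraph : ∀ k : ℝ → E, (∀ᶠ t in 𝓝 τ, HasDerivAt k (V (t, k t)) t) → k τ = f τ →
      ∀ᶠ t in 𝓝 τ, (t, k t) ∈ U := by
    intro k hk hkτ
    have hc : ContinuousAt (fun t => (t, k t)) τ :=
      continuousAt_id.prodMk hk.self_of_nhds.continuousAt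
    exact hc (by simpa only [hkτ] using hU)
  refine ODE_solution_unique_of_eventually (v := fun t y => V (t, y)) (K := K)
    (s := fun t => {y | (t, y) ∈ U}) (Eventually.of_forall fun t => ?_)
    (hf.and (hgraph f hf rfl)) (hg.and (hgraph g hg h.symm)) h
  have := hK.comp ((LipschitzWith.prodMk_left t).lipschitzOnWith (s := {y : E | (t, y) ∈ U}))
    fun y hy => hy
  simpa [Function.comp_def] using this

/-- Global solutions of a locally Lipschitz differential equation which agree at one time are
equal. -/
lemma eq_of_hasDerivAt_of_lipschitzNear {V : ℝ × E → E} (hV : ∀ z, LipschitzNear V z)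
    {f g : ℝ → E} (hf : ∀ t, HasDerivAt f (V (t, f t)) t) (hg : ∀ t, HasDerivAt g (V (t, g t)) t)
    {τ : ℝ} (h : f τ = g τ) : f = g := by
  have hfc : Continuous f := continuous_iff_continuousAt.2 fun t => (hf t).continuousAt
  have hgc : Continuous g := continuous_iff_continuousAt.2 fun t => (hg t).continuousAt
  have hclopen : IsClopen {t | f t = g t} :=
    ⟨isClosed_eq hfc hgc, isOpen_iff_eventually.2 fun t ht =>
      (hV (t, f t)).eventuallyEq_of_hasDerivAt (.of_forall hf) (.of_forall hg) ht⟩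
  exact funext (eq_univ_iff_forall.1 (hclopen.eq_univ ⟨τ, h⟩))

end ODE

section SliceGradient

variable {M E : Type*} [NormedAddCommGroup M] [NormedSpace ℝ M]
  [NormedAddCommGroup E] [InnerProductSpace ℝ E] [CompleteSpace E]

/-- The gradient of `f : M → ℝ` in the directions of the image of `A : E →L[ℝ] M`. -/
noncomputable def sliceGradient (A : E →L[ℝ] M) (f : M → ℝ) (z : M) : E :=
  (toDual ℝ E).symm ((fderiv ℝ f z).comp A)

lemma inner_sliceGradient (A : E →L[ℝ] M) (f : M → ℝ) (z : M) (v : E) :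
    ⟪sliceGradient A f z, v⟫ = fderiv ℝ f z (A v) := by
  simp [sliceGradient]

lemma gradient_eq_sliceGradient {A : E →L[ℝ] M} {f : M → ℝ} {g : E → M} {y : E}
    (hg : HasFDerivAt g A y) (hf : DifferentiableAt ℝ f (g y)) :
    gradient (fun x => f (g x)) y = sliceGradient A f (g y) := by
  rw [gradient, sliceGradient]
  congr 1
  exact (hf.hasFDerivAt.comp y hg).fderiv

lemma LipschitzNear.sliceGradient {f : M → ℝ} {z : M} (hf : LipschitzNear (fderiv ℝ f) z)
    (A : E →L[ℝ] M) : LipschitzNear (sliceGradient A f) z := by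
  have h : LipschitzWith ‖A‖₊
      fun L : M →L[ℝ] ℝ => (toDual ℝ E).symm (L.comp A) := by
    refine LipschitzWith.of_dist_le_mul fun L L' => ?_
    rw [LinearIsometryEquiv.dist_map, dist_eq_norm, dist_eq_norm, ← ContinuousLinearMap.sub_comp,
      mul_comm]
    exact ContinuousLinearMap.opNorm_comp_le _ _
  exact (h.lipschitzNear _).comp hf

end SliceGradient

section Momentum

variable {E : Type*} [NormedAddCommGroup E] [InnerProductSpace ℝ E]

/-- Let `u` solve a Hamilton–Jacobi equation near `(τ, q τ)`, with spatial gradient `P`. If `q`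
moves with velocity `∂_p F` at time `τ`, then `t ↦ P (t, q t)` is weakly differentiable at `τ`, with
derivative `-∂_q F`. -/
lemma hasDerivAt_inner_of_hamiltonJacobi {F : ℝ × E × E → ℝ} {F' : ℝ × E × E →L[ℝ] ℝ}
    {u : ℝ × E → ℝ} {P : ℝ × E → E} {q q' : ℝ → E} {τ : ℝ}
    (hF : HasStrictFDerivAt F F' (τ, q τ, P (τ, q τ)))
    (hu : ∀ᶠ z in 𝓝 (τ, q τ), DifferentiableAt ℝ u z ∧
      ∀ a b, fderiv ℝ u z (a, b) = -(a * F (z.1, z.2, P z)) + ⟪P z, b⟫)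
    (hP : LipschitzNear P (τ, q τ))
    (hq : ∀ᶠ t in 𝓝 τ, HasDerivAt q (q' t) t) (hq' : ContinuousAt q' τ)
    (hF' : ∀ w, F' (0, 0, w) = ⟪w, q' τ⟫) (v : E) :
    HasDerivAt (fun t => ⟪P (t, q t), v⟫) (-F' (0, v, 0)) τ := by
  have hqc : ContinuousAt q τ := hq.self_of_nhds.continuousAt
  obtain ⟨K, U, hU, hK⟩ := hP
  set L : Filter (ℝ × ℝ) := 𝓝[≠] (0 : ℝ) ×ˢ 𝓝 τ
  have hLne : ∀ᶠ n in L, n.1 ≠ 0 := tendsto_fst.eventually self_mem_nhdsWithin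
  have hqL : Tendsto (fun n : ℝ × ℝ => q n.2) L (𝓝 (q τ)) := hqc.tendsto.comp tendsto_snd
  have hfst : Tendsto (fun n : ℝ × ℝ => n.1) L (𝓝 0) :=
    tendsto_fst.mono_right nhdsWithin_le_nhds
  have hsnd : Tendsto (fun n : ℝ × ℝ => n.2) L (𝓝 τ) := tendsto_snd
  set z₀ : ℝ × ℝ → ℝ × E := fun n => (n.2, q n.2) with hz₀
  set z₁ : ℝ × ℝ → ℝ × E := fun n => (n.2, q n.2 + n.1 • v) with hz₁
  have hz₀L : Tendsto z₀ L (𝓝 (τ, q τ)) := hsnd.prodMk_nhds hqL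
  have hz₁L : Tendsto z₁ L (𝓝 (τ, q τ)) := by
    refine hsnd.prodMk_nhds ?_
    simpa using hqL.add (hfst.smul_const v)
  have hPc : Tendsto P (𝓝 (τ, q τ)) (𝓝 (P (τ, q τ))) := hK.continuousOn.continuousAt hU
  have hPO : (fun n => P (z₁ n) - P (z₀ n)) =O[L] fun n => n.1 := by
    refine IsBigO.of_bound (K * ‖v‖) ?_
    filter_upwards [hz₀L hU, hz₁L hU] with n h0 h1
    refine (hK.norm_sub_le h1 h0).trans_eq ?_
    simp only [hz₀, hz₁, Prod.mk_sub_mk, sub_self, add_sub_cancel_left, Prod.norm_mk, norm_zero,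
      norm_smul]
    rw [max_eq_right (by positivity)]
    ring
  set A : ℝ × ℝ → ℝ × E × E := fun n => (n.2, q n.2 + n.1 • v, P (z₁ n)) with hA
  set B : ℝ × ℝ → ℝ × E × E := fun n => (n.2, q n.2, P (z₀ n)) with hB
  have hAL : Tendsto A L (𝓝 (τ, q τ, P (τ, q τ))) :=
    hsnd.prodMk_nhds ((continuous_snd.tendsto _ |>.comp hz₁L).prodMk_nhds (hPc.comp hz₁L))
  have hBL : Tendsto B L (𝓝 (τ, q τ, P (τ, q τ))) :=
    hsnd.prodMk_nhds (hqL.prodMk_nhds (hPc.comp hz₀L))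
  have hAB : ∀ n, A n - B n = (0, n.1 • v, P (z₁ n) - P (z₀ n)) := by
    intro n; simp [hA, hB]
  have hABO : (fun n => A n - B n) =O[L] fun n => n.1 := by
    simp only [hAB]
    refine (isBigO_zero _ _).prod_left (IsBigO.prod_left ?_ hPO)
    exact IsBigO.of_bound ‖v‖ (.of_forall fun n => by rw [norm_smul, mul_comm])
  have hstrict : (fun n => F (A n) - F (B n) - F' (A n - B n)) =o[L] fun n => n.1 :=
    (hF.isLittleO.comp_tendsto (hAL.prodMk_nhds hBL)).trans_isBigO hABO
  have hvel : (fun n => ⟪P (z₁ n) - P (z₀ n), q' n.2 - q' τ⟫) =o[L] fun n => n.1 := by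
    have h1 : Tendsto (fun n : ℝ × ℝ => q' n.2 - q' τ) L (𝓝 0) := by
      simpa using (hq'.tendsto.comp hsnd).sub_const (q' τ)
    have h2 := (hPO.norm_left).mul_isLittleO ((isLittleO_one_iff ℝ).2 h1).norm_left
    refine (IsBigO.of_bound 1 (.of_forall fun n => ?_)).trans_isLittleO
      (h2.congr_right fun n => mul_one _)
    rw [one_mul, norm_mul, norm_norm, norm_norm]
    exact norm_inner_le_norm _ _
  set D : ℝ → ℝ → ℝ := fun l t =>
    l⁻¹ * (fderiv ℝ u (z₁ (l, t)) (1, q' t) - fderiv ℝ u (z₀ (l, t)) (1, q' t)) with hD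
  have hDL : Tendsto (fun n : ℝ × ℝ => D n.1 n.2) L (𝓝 (-F' (0, v, 0))) := by
    have h := (hvel.sub hstrict).tendsto_div_nhds_zero.add_const (-F' (0, v, 0))
    rw [zero_add] at h
    refine h.congr' ?_
    filter_upwards [hLne, hz₀L.eventually hu, hz₁L.eventually hu] with n hn h0 h1
    have hsplit : F' (A n - B n) = n.1 * F' (0, v, 0) + ⟪P (z₁ n) - P (z₀ n), q' τ⟫ := by
      rw [hAB, ← hF', ← smul_eq_mul, ← map_smul, ← map_add]
      simp
    simp only [hD]
    rw [hsplit, h0.2, h1.2, inner_sub_right, inner_sub_left (y := P (z₀ n)) (z := q' n.2)]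
    simp only [hA, hB, hz₀, hz₁]
    field_simp
    ring
  refine hasDerivAt_of_tendstoUniformlyOnFilter (l := 𝓝[≠] (0 : ℝ))
    (f := fun l t => l⁻¹ * (u (z₁ (l, t)) - u (z₀ (l, t)))) (f' := D)
    (g' := fun _ => -F' (0, v, 0)) ?_ ?_ ?_
  · rw [Metric.tendstoUniformlyOnFilter_iff]
    intro ε hε
    filter_upwards [Metric.tendsto_nhds.1 hDL ε hε] with n hn
    rwa [dist_comm]
  · filter_upwards [hz₀L.eventually hu, hz₁L.eventually hu, hsnd.eventually hq] with n h0 h1 hqn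
    have e0 : HasDerivAt (fun t => u (z₀ (n.1, t))) (fderiv ℝ u (z₀ n) (1, q' n.2)) n.2 :=
      h0.1.hasFDerivAt.comp_hasDerivAt n.2 ((hasDerivAt_id n.2).prodMk hqn)
    have e1 : HasDerivAt (fun t => u (z₁ (n.1, t))) (fderiv ℝ u (z₁ n) (1, q' n.2)) n.2 :=
      h1.1.hasFDerivAt.comp_hasDerivAt n.2 ((hasDerivAt_id n.2).prodMk (hqn.add_const (n.1 • v)))
    exact (e1.sub e0).const_mul _
  · have hgraph : Tendsto (fun t => (t, q t)) (𝓝 τ) (𝓝 (τ, q τ)) :=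
      continuousAt_id.prodMk hqc
    filter_upwards [hgraph.eventually hu] with t ht
    have hline : HasDerivAt (fun l : ℝ => (t, q t + l • v)) (0, v) 0 :=
      (hasDerivAt_const _ _).prodMk
        (by simpa using ((hasDerivAt_id (0 : ℝ)).smul_const v).const_add (q t))
    have ht' : HasFDerivAt u (fderiv ℝ u (t, q t)) ((fun l : ℝ => (t, q t + l • v)) 0) := by
      simpa using ht.1.hasFDerivAt
    have h := (ht'.comp_hasDerivAt (0 : ℝ) hline).tendsto_slope_zero
    rw [ht.2] at h
    simpa [hz₀, hz₁] using h

lemma hasDerivAt_of_inner [FiniteDimensional ℝ E] {p : ℝ → E} {p' : E} {t : ℝ}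
    (h : ∀ v, HasDerivAt (fun s => ⟪p s, v⟫) ⟪p', v⟫ t) : HasDerivAt p p' t := by
  set b := stdOrthonormalBasis ℝ E
  have hsum : ∀ x : E, ∑ i, ⟪x, b i⟫ • b i = x := fun x => by
    simp_rw [real_inner_comm (b _) x]
    exact b.sum_repr' x
  have h' := HasDerivAt.fun_sum (u := Finset.univ) fun i _ => (h (b i)).smul_const (b i)
  simpa only [hsum] using h'

end Momentum

section HamiltonianSystem

variable {E : Type*} [NormedAddCommGroup E] [InnerProductSpace ℝ E] [CompleteSpace E]

/-- The inclusion of positions into extended phase space `ℝ × E × E`. -/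
noncomputable def positionInl (E : Type*) [NormedAddCommGroup E] [InnerProductSpace ℝ E] :
    E →L[ℝ] ℝ × E × E :=
  (ContinuousLinearMap.inr ℝ ℝ (E × E)).comp (ContinuousLinearMap.inl ℝ E E)

/-- The inclusion of momenta into extended phase space `ℝ × E × E`. -/
noncomputable def momentumInr (E : Type*) [NormedAddCommGroup E] [InnerProductSpace ℝ E] :
    E →L[ℝ] ℝ × E × E :=
  (ContinuousLinearMap.inr ℝ ℝ (E × E)).comp (ContinuousLinearMap.inr ℝ E E)

/-- The time-dependent Hamiltonian vector field `(∂_p F, -∂_q F)` of `F`. -/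
noncomputable def hamiltonianField (F : ℝ × E × E → ℝ) (z : ℝ × E × E) : E × E :=
  (sliceGradient (momentumInr E) F z, -sliceGradient (positionInl E) F z)

lemma lipschitzNear_fderiv {M : Type*} [NormedAddCommGroup M] [NormedSpace ℝ M] {F : M → ℝ}
    (hF : ContDiff ℝ 2 F) (z : M) : LipschitzNear (fderiv ℝ F) z := by
  exact ((hF.fderiv_right (m := 1) (by norm_num)).hasStrictFDerivAt one_ne_zero
    (x := z)).exists_lipschitzOnWith

lemma lipschitzNear_hamiltonianField {F : ℝ × E × E → ℝ} (hF : ContDiff ℝ 2 F)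
    (z : ℝ × E × E) : LipschitzNear (hamiltonianField F) z := by
  have hneg : LipschitzNear (fun y : E => -y) (sliceGradient (positionInl E) F z) :=
    LipschitzWith.id.neg.lipschitzNear _
  exact ((lipschitzNear_fderiv hF z).sliceGradient _).prodMk
    (hneg.comp ((lipschitzNear_fderiv hF z).sliceGradient _))

lemma hamiltonianField_eq {F : ℝ × E × E → ℝ} (hF : Differentiable ℝ F) (t : ℝ) (q p : E) :
    (gradient (fun p' => F (t, q, p')) p, -gradient (fun q' => F (t, q', p)) q) =
      hamiltonianField F (t, q, p) := by
  have hp : HasFDerivAt (fun p' : E => (t, q, p')) (momentumInr E) p :=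
    (hasFDerivAt_prodMk_right t (q, p)).comp p (hasFDerivAt_prodMk_right q p)
  have hq : HasFDerivAt (fun q' : E => (t, q', p)) (positionInl E) q :=
    (hasFDerivAt_prodMk_right t (q, p)).comp q (hasFDerivAt_prodMk_left q p)
  rw [hamiltonianField, gradient_eq_sliceGradient hp (hF _), gradient_eq_sliceGradient hq (hF _)]

/-- A solution of the Hamiltonian system starting on the graph of the spatial gradient of a
`C^{1,1}` solution of the Hamilton–Jacobi equation stays on it for a short time. -/
lemma eventually_mem_graph [FiniteDimensional ℝ E] {F : ℝ × E × E → ℝ}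
    (hF : ContDiff ℝ 2 F) {u : ℝ × E → ℝ}
    {P : ℝ × E → E}
    {γ : ℝ → E × E} {τ : ℝ}
    (hγ : ∀ᶠ t in 𝓝 τ, HasDerivAt γ (hamiltonianField F (t, γ t)) t)
    (hu : ∀ᶠ z in 𝓝 (τ, (γ τ).1), DifferentiableAt ℝ u z ∧
      ∀ a b, fderiv ℝ u z (a, b) = -(a * F (z.1, z.2, P z)) + ⟪P z, b⟫)
    (hP : LipschitzNear P (τ, (γ τ).1)) (hτ : (γ τ).2 = P (τ, (γ τ).1)) :
    ∀ᶠ t in 𝓝 τ, (γ t).2 = P (t, (γ t).1) := by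
  set V : ℝ × E → E := fun z => sliceGradient (momentumInr E) F (z.1, z.2, P z)
  have hV : ∀ z, LipschitzNear P z → LipschitzNear V z := fun z hz =>
    ((lipschitzNear_fderiv hF _).sliceGradient (momentumInr E)).comp
      ((LipschitzWith.prod_fst.lipschitzNear z).prodMk
        ((LipschitzWith.prod_snd.lipschitzNear z).prodMk hz))
  obtain ⟨q, hq0, hq⟩ := (hV _ hP).exists_eventually_hasDerivAt
  have hgraph : Tendsto (fun t => (t, q t)) (𝓝 τ) (𝓝 (τ, (γ τ).1)) := by
    rw [← hq0]
    exact continuousAt_id.prodMk hq.self_of_nhds.continuousAt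
  have hlift : ∀ᶠ t in 𝓝 τ,
      HasDerivAt (fun s => (q s, P (s, q s))) (hamiltonianField F (t, q t, P (t, q t))) t := by
    filter_upwards [hq.eventually_nhds, hgraph.eventually hu.eventually_nhds,
      hgraph.eventually hP.eventually_nhds] with t hqt hut hPt
    refine hqt.self_of_nhds.prodMk (hasDerivAt_of_inner fun v => ?_)
    have hVq : ContinuousAt (fun s => V (s, q s)) t :=
      (hV _ hPt).continuousAt.comp (f := fun s => (s, q s))
        (continuousAt_id.prodMk hqt.self_of_nhds.continuousAt)
    rw [inner_neg_left, inner_sliceGradient]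
    refine hasDerivAt_inner_of_hamiltonJacobi (hF.hasStrictFDerivAt two_ne_zero) hut hPt hqt hVq
      (fun w => ?_) v
    rw [real_inner_comm, inner_sliceGradient]
    rfl
  have heq := (lipschitzNear_hamiltonianField hF (τ, γ τ)).eventuallyEq_of_hasDerivAt hγ hlift
    (by rw [hq0, ← hτ])
  filter_upwards [heq] with t ht
  rw [ht]

end HamiltonianSystem

/-- Let `u` be a `C^{1,1}_loc` solution of the Hamilton–Jacobi equation on
`(t₀,t₁) × ℝᵈ`, for a `C²` Hamiltonian with complete flow `φ`. Then through every point of the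
graph of `∂_q u(s, ·)` there is a solution of the Hamiltonian system staying in the graphs, and
the graphs `Γ_t` satisfy `Γ_t = φ_s^t(Γ_s)`. -/
theorem invariance_of_graphs {d : ℕ}
    (H : ℝ → EuclideanSpace ℝ (Fin d) → EuclideanSpace ℝ (Fin d) → ℝ)
    (hH : ContDiff ℝ 2 (fun x : ℝ × EuclideanSpace ℝ (Fin d) × EuclideanSpace ℝ (Fin d) =>
      H x.1 x.2.1 x.2.2))
    -- `φ s t` is the (complete) flow of the Hamiltonian system from time `s` to time `t`
    (φ : ℝ → ℝ → EuclideanSpace ℝ (Fin d) × EuclideanSpace ℝ (Fin d) →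
      EuclideanSpace ℝ (Fin d) × EuclideanSpace ℝ (Fin d))
    (hφ_init : ∀ s x, φ s s x = x)
    (hφ_ode : ∀ s x t, HasDerivAt (fun τ => φ s τ x)
      (gradient (fun p' => H t (φ s t x).1 p') (φ s t x).2,
        -gradient (fun q' => H t q' (φ s t x).2) (φ s t x).1) t)
    (t₀ t₁ : ℝ)
    (u : ℝ × EuclideanSpace ℝ (Fin d) → ℝ)
    -- `u` is differentiable on `(t₀,t₁) × ℝᵈ` ...
    (hu_diff : ∀ z : ℝ × EuclideanSpace ℝ (Fin d), z.1 ∈ Ioo t₀ t₁ → DifferentiableAt ℝ u z)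
    -- ... with locally Lipschitz differential
    (hu_lip : ∀ z : ℝ × EuclideanSpace ℝ (Fin d), z.1 ∈ Ioo t₀ t₁ →
      ∃ ε > 0, ball z ε ⊆ Ioo t₀ t₁ ×ˢ (univ : Set (EuclideanSpace ℝ (Fin d))) ∧
      ∃ K : ℝ≥0, LipschitzOnWith K (fun w => fderiv ℝ u w) (ball z ε))
    -- `u` solves the Hamilton–Jacobi equation
    (hu_HJ : ∀ t ∈ Ioo t₀ t₁, ∀ y : EuclideanSpace ℝ (Fin d),
      deriv (fun τ => u (τ, y)) t + H t y (gradient (fun y' => u (t, y')) y) = 0) :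
    -- part 1: characteristics through every point of the graph
    (∀ s ∈ Ioo t₀ t₁, ∀ qs ps : EuclideanSpace ℝ (Fin d),
      ps = gradient (fun y => u (s, y)) qs →
      ∃ γ : ℝ → EuclideanSpace ℝ (Fin d) × EuclideanSpace ℝ (Fin d),
        γ s = (qs, ps) ∧
        (∀ t ∈ Ioo t₀ t₁, HasDerivAt γ
          (gradient (fun p' => H t (γ t).1 p') (γ t).2,
            -gradient (fun q' => H t q' (γ t).2) (γ t).1) t) ∧
        (∀ t ∈ Ioo t₀ t₁, (γ t).2 = gradient (fun y => u (t, y)) (γ t).1)) ∧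
    -- part 2: `Γ_t = φ_s^t(Γ_s)`
    (∀ s ∈ Ioo t₀ t₁, ∀ t ∈ Ioo t₀ t₁,
      (Set.range fun y : EuclideanSpace ℝ (Fin d) => (y, gradient (fun y' => u (t, y')) y)) =
        φ s t '' (Set.range fun y : EuclideanSpace ℝ (Fin d) =>
          (y, gradient (fun y' => u (s, y')) y))) := by
  set F : ℝ × EuclideanSpace ℝ (Fin d) × EuclideanSpace ℝ (Fin d) → ℝ :=
    fun x => H x.1 x.2.1 x.2.2
  have hFd : Differentiable ℝ F := hH.differentiable two_ne_zero
  set P : ℝ × EuclideanSpace ℝ (Fin d) → EuclideanSpace ℝ (Fin d) :=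
    sliceGradient (ContinuousLinearMap.inr ℝ ℝ (EuclideanSpace ℝ (Fin d))) u with hPdef
  have hfield : ∀ (t : ℝ) (z : EuclideanSpace ℝ (Fin d) × EuclideanSpace ℝ (Fin d)),
      (gradient (fun p' => H t z.1 p') z.2,
      -gradient (fun q' => H t q' z.2) z.1) = hamiltonianField F (t, z) :=
    fun t z => hamiltonianField_eq hFd t z.1 z.2
  have hgrad : ∀ t ∈ Ioo t₀ t₁, ∀ y, gradient (fun y' => u (t, y')) y = P (t, y) :=
    fun t ht y => gradient_eq_sliceGradient (hasFDerivAt_prodMk_right t y) (hu_diff (t, y) ht)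
  have hP : ∀ t ∈ Ioo t₀ t₁, ∀ y, LipschitzNear P (t, y) := by
    intro t ht y
    obtain ⟨ε, hε, -, K, hK⟩ := hu_lip (t, y) ht
    exact LipschitzNear.sliceGradient ⟨K, _, ball_mem_nhds _ hε, hK⟩ _
  have hu : ∀ t ∈ Ioo t₀ t₁, ∀ y, ∀ᶠ z in 𝓝 (t, y), DifferentiableAt ℝ u z ∧
      ∀ a b, fderiv ℝ u z (a, b) = -(a * F (z.1, z.2, P z)) + ⟪P z, b⟫ := by
    intro t ht y
    have hmem : ∀ᶠ z : ℝ × EuclideanSpace ℝ (Fin d) in 𝓝 (t, y), z.1 ∈ Ioo t₀ t₁ :=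
      continuous_fst.continuousAt.eventually (Ioo_mem_nhds ht.1 ht.2)
    filter_upwards [hmem] with z hz
    refine ⟨hu_diff z hz, fun a b => ?_⟩
    have htime : HasDerivAt (fun τ => u (τ, z.2)) (fderiv ℝ u z (1, 0)) z.1 :=
      (hu_diff z hz).hasFDerivAt.comp_hasDerivAt z.1
        ((hasDerivAt_id z.1).prodMk (hasDerivAt_const z.1 z.2))
    have hHJ := hu_HJ z.1 hz z.2
    rw [htime.deriv, hgrad z.1 hz] at hHJ
    have hsplit : fderiv ℝ u z (a, b) = a * fderiv ℝ u z (1, 0) + fderiv ℝ u z (0, b) := by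
      rw [← smul_eq_mul, ← map_smul, ← map_add]
      simp
    rw [hsplit, hPdef, inner_sliceGradient, eq_neg_of_add_eq_zero_left hHJ,
      ContinuousLinearMap.inr_apply, mul_neg]
  have hφ : ∀ s x t, HasDerivAt (fun τ => φ s τ x) (hamiltonianField F (t, φ s t x)) t :=
    fun s x t => hfield t (φ s t x) ▸ hφ_ode s x t
  have hinv : ∀ s ∈ Ioo t₀ t₁, ∀ y, ∀ t ∈ Ioo t₀ t₁,
      (φ s t (y, P (s, y))).2 = P (t, (φ s t (y, P (s, y))).1) := by
    intro s hs y
    set γ : ℝ → EuclideanSpace ℝ (Fin d) × EuclideanSpace ℝ (Fin d) :=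
      fun t => φ s t (y, P (s, y))
    have hγ : ∀ t, HasDerivAt γ (hamiltonianField F (t, γ t)) t := hφ s _
    have hγs : γ s = (y, P (s, y)) := hφ_init s _
    set A : Set ℝ := {t | t ∈ Ioo t₀ t₁ ∧ (γ t).2 = P (t, (γ t).1)}
    have hAopen : IsOpen A := isOpen_iff_eventually.2 fun τ hτ =>
      (isOpen_Ioo.eventually_mem hτ.1).and
        (eventually_mem_graph hH (.of_forall hγ) (hu τ hτ.1 _) (hP τ hτ.1 _) hτ.2)
    have hAclosed : closure A ∩ Ioo t₀ t₁ ⊆ A := by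
      rintro τ ⟨hτ, hτI⟩
      have hc : ContinuousAt (fun t => (γ t).2 - P (t, (γ t).1)) τ :=
        (hγ τ).continuousAt.snd.sub ((hP τ hτI _).continuousAt.comp (f := fun t => (t, (γ t).1))
          (continuousAt_id.prodMk (hγ τ).continuousAt.fst))
      have hfreq : ∃ᶠ t in 𝓝 τ,
          (γ t).2 - P (t, (γ t).1) ∈ ({0} : Set (EuclideanSpace ℝ (Fin d))) :=
        (mem_closure_iff_frequently.1 hτ).mono fun t ht => sub_eq_zero.2 ht.2
      exact ⟨hτI, sub_eq_zero.1 (isClosed_singleton.mem_of_frequently_of_tendsto hfreq hc)⟩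
    have hsub : Ioo t₀ t₁ ⊆ A := isPreconnected_Ioo.subset_of_closure_inter_subset hAopen
      ⟨s, hs, hs, by rw [hγs]⟩ hAclosed
    exact fun t ht => (hsub ht).2
  refine ⟨fun s hs qs ps hps => ?_, fun s hs t ht => ?_⟩
  · rw [hgrad s hs] at hps
    subst hps
    exact ⟨fun t => φ s t (qs, P (s, qs)), hφ_init s _, fun t _ => hφ_ode s _ t,
      fun t ht => (hinv s hs qs t ht).trans (hgrad t ht _).symm⟩
  · have hflow : ∀ x, φ s t (φ t s x) = x := fun x => by
      have h := eq_of_hasDerivAt_of_lipschitzNear (V := hamiltonianField F)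
        (f := fun τ => φ s τ (φ t s x)) (g := fun τ => φ t τ x) (τ := s)
        (lipschitzNear_hamiltonianField hH)
        (hφ s (φ t s x)) (hφ t x) (hφ_init s (φ t s x))
      exact (congrFun h t).trans (hφ_init t x)
    simp only [hgrad s hs, hgrad t ht]
    refine Subset.antisymm ?_ ?_
    · rintro _ ⟨y, rfl⟩
      exact ⟨φ t s (y, P (t, y)), ⟨(φ t s (y, P (t, y))).1, Prod.ext rfl (hinv t ht y s hs).symm⟩,
        hflow (y, P (t, y))⟩
    · rintro _ ⟨_, ⟨y, rfl⟩, rfl⟩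
      exact ⟨(φ s t (y, P (s, y))).1, Prod.ext rfl (hinv s hs y t ht).symm⟩
end

section
/- Let H(t,q,p) : ℝ × ℝ^d × ℝ^d → ℝ be a C² Hamiltonian whose Hamiltonian system (HS) is complete, i.e. every maximal solution is defined on all of ℝ. Let (t₀,t₁) be an open interval containing 0 and let u₀ : ℝ^d → ℝ be a C^{1,1}_loc function. Then there is at most one C^{1,1}_loc solution u(t,q) : (t₀,t₁) × ℝ^d → ℝ of the Hamilton–Jacobi equation (HJ) such that u(0,q) = u₀(q) for all q ∈ ℝ^d. -/
open scoped RealInnerProductSpace NNReal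
open Set Metric

open Filter Topology in
/-- If `u` solves the Hamilton–Jacobi equation near `(s, q s)` with Lipschitz momentum field `P`,
then a Hamiltonian trajectory `(q, p)` lying on the graph of `P` at time `s` stays on it nearby. -/
theorem eventually_mem_graph_of_hamiltonian_trajectory {E : Type*} [NormedAddCommGroup E]
    [InnerProductSpace ℝ E] {F : ℝ × E × E → ℝ} (hF : ContDiff ℝ 2 F)
    {u : ℝ × E → ℝ} {P : ℝ × E → E} {q p q' p' : ℝ → E} {s ε : ℝ} {K : ℝ≥0} (hε : 0 < ε)
    (hu : ∀ z ∈ ball (s, q s) ε, DifferentiableAt ℝ u z)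
    (hP : ∀ z ∈ ball (s, q s) ε, ∀ τ ξ,
      fderiv ℝ u z (τ, ξ) = ⟪P z, ξ⟫ - τ * F (z.1, z.2, P z))
    (hPlip : LipschitzOnWith K P (ball (s, q s) ε))
    (hq : ∀ t, HasDerivAt q (q' t) t) (hp : ∀ t, HasDerivAt p (p' t) t)
    (hq' : ∀ t ξ, ⟪q' t, ξ⟫ = fderiv ℝ F (t, q t, p t) (0, 0, ξ))
    (hp' : ∀ t ξ, ⟪p' t, ξ⟫ = -fderiv ℝ F (t, q t, p t) (0, ξ, 0))
    (hs : p s = P (s, q s)) : ∀ᶠ t in 𝓝 s, p t = P (t, q t) := by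
  have hqc : Continuous q := continuous_iff_continuousAt.2 fun t => (hq t).continuousAt
  have hpc : Continuous p := continuous_iff_continuousAt.2 fun t => (hp t).continuousAt
  have hF1 : ContDiffAt ℝ 1 (fderiv ℝ F) (s, q s, p s) :=
    (hF.fderiv_right (by norm_num)).contDiffAt
  obtain ⟨L, B, hB, hL⟩ := hF1.exists_lipschitzOnWith
  obtain ⟨ρ, hρ, hρB⟩ := Metric.mem_nhds_iff.1 hB
  have hPs : ContinuousAt P (s, q s) :=
    hPlip.continuousOn.continuousAt (ball_mem_nhds _ hε)
  -- the lifted points stay in the ball where `fderiv F` is Lipschitz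
  have hlift : ∀ᶠ x : ℝ × E in 𝓝 (s, 0), (x.1, q x.1 + x.2) ∈ ball (s, q s) ε ∧
      (x.1, q x.1 + x.2, P (x.1, q x.1 + x.2)) ∈ ball (s, q s, p s) ρ := by
    have h1 : Tendsto (fun x : ℝ × E => (x.1, q x.1 + x.2)) (𝓝 (s, 0)) (𝓝 (s, q s)) := by
      have : Continuous (fun x : ℝ × E => (x.1, q x.1 + x.2)) := by fun_prop
      simpa using this.tendsto (s, 0)
    have h2 : Tendsto (fun x : ℝ × E => (x.1, q x.1 + x.2, P (x.1, q x.1 + x.2)))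
        (𝓝 (s, 0)) (𝓝 (s, q s, p s)) := by
      rw [hs]
      have h3 := (continuous_snd.tendsto (s, q s)).comp h1
      exact (h1.fst_nhds).prodMk_nhds (h3.prodMk_nhds (hPs.tendsto.comp h1))
    exact (h1.eventually_mem (ball_mem_nhds _ hε)).and (h2.eventually_mem (ball_mem_nhds _ hρ))
  have htraj : ∀ᶠ t in 𝓝 s, (t, q t, p t) ∈ ball (s, q s, p s) ρ :=
    (continuous_id.prodMk (hqc.prodMk hpc)).continuousAt (ball_mem_nhds _ hρ)
  obtain ⟨δ₁, hδ₁, hδ₁'⟩ := Metric.eventually_nhds_iff_ball.1 hlift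
  obtain ⟨δ₂, hδ₂, hδ₂'⟩ := Metric.eventually_nhds_iff_ball.1 htraj
  set K' : ℝ := K + 1 with hK'
  have hK'pos : 0 < K' := by positivity
  obtain ⟨δ, hδ, hδ1, hδ2, hδ3⟩ : ∃ δ > 0, δ < δ₁ ∧ δ < δ₂ ∧ 2 * (L * K' * δ) ≤ 1 / 2 := by
    refine ⟨min (min (δ₁ / 2) (δ₂ / 2)) (1 / (4 * (L * K' + 1))), by positivity, ?_, ?_, ?_⟩
    · exact (min_le_left _ _).trans_lt ((min_le_left _ _).trans_lt (by linarith))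
    · exact (min_le_left _ _).trans_lt ((min_le_right _ _).trans_lt (by linarith))
    · have h0 : (0 : ℝ) ≤ L * K' := by positivity
      have := mul_le_mul_of_nonneg_left
        (min_le_right (min (δ₁ / 2) (δ₂ / 2)) (1 / (4 * (L * K' + 1)))) h0
      have h2 : L * K' * (1 / (4 * (L * K' + 1))) ≤ 1 / 4 := by
        rw [mul_one_div, div_le_div_iff₀ (by positivity) (by norm_num)]
        linarith
      linarith
  have hmem : ∀ t ∈ closedBall s δ, ∀ h : E, ‖h‖ < δ₁ → (t, q t + h) ∈ ball (s, q s) ε ∧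
      (t, q t + h, P (t, q t + h)) ∈ ball (s, q s, p s) ρ := fun t ht h hh =>
    hδ₁' (t, h) (by
      rw [← ball_prod_same]
      exact ⟨closedBall_subset_ball hδ1 ht, by simpa using hh⟩)
  have hmem0 : ∀ t ∈ closedBall s δ, (t, q t) ∈ ball (s, q s) ε ∧
      (t, q t, P (t, q t)) ∈ ball (s, q s, p s) ρ := fun t ht => by
    simpa using hmem t ht 0 (by simpa using hδ₁)
  have htr : ∀ t ∈ closedBall s δ, (t, q t, p t) ∈ ball (s, q s, p s) ρ := fun t ht =>
    hδ₂' t (closedBall_subset_ball hδ2 ht)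
  set r : ℝ → E := fun t => P (t, q t) - p t with hr
  have hrc : ContinuousOn r (closedBall s δ) := by
    refine ContinuousOn.sub (hPlip.continuousOn.comp (by fun_prop) fun t ht => (hmem0 t ht).1)
      hpc.continuousOn
  obtain ⟨m, hm, hmax⟩ := (isCompact_closedBall s δ).exists_isMaxOn
    ⟨s, mem_closedBall_self hδ.le⟩ hrc.norm
  set M : ℝ := ‖r m‖ with hM
  have hmax' : ∀ t ∈ closedBall s δ, ‖r t‖ ≤ M := fun t ht => hmax ht
  -- the defect of the linearised generating function along the trajectory
  set ψ : E → ℝ → ℝ := fun h t => u (t, q t + h) - u (t, q t) - ⟪p t, h⟫ with hψ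
  have hψ' : ∀ t ∈ closedBall s δ, ∀ h : E, ‖h‖ < δ₁ → ∃ c, HasDerivAt (ψ h) c t ∧
      ‖c‖ ≤ L * (M + K' * ‖h‖) * (K' * ‖h‖) := by
    intro t ht h hh
    have hz := (hmem t ht h hh).1
    have hz0 := (hmem0 t ht).1
    have d1 := (hu _ hz).hasFDerivAt.comp_hasDerivAt t
      ((hasDerivAt_id t).prodMk ((hq t).add_const h))
    have d2 := (hu _ hz0).hasFDerivAt.comp_hasDerivAt t ((hasDerivAt_id t).prodMk (hq t))
    have d3 := (hp t).inner ℝ (hasDerivAt_const t h)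
    refine ⟨_, (d1.sub d2).sub d3, ?_⟩
    rw [hP _ hz, hP _ hz0]
    set b := P (t, q t + h) with hb
    set a := P (t, q t) with ha
    have hba : ‖b - a‖ ≤ K * ‖h‖ := by
      have := hPlip.norm_sub_le hz hz0
      simpa using this
    have hlin : fderiv ℝ F (t, q t, p t) ((t, q t + h, b) - (t, q t, a))
        = ⟪b, q' t⟫ - ⟪a, q' t⟫ - ⟪p' t, h⟫ := by
      have : ((t, q t + h, b) - (t, q t, a) : ℝ × E × E) = (0, 0, b - a) + (0, h, 0) := by
        simp
      rw [this, map_add, ← hq', hp', inner_sub_right, real_inner_comm b, real_inner_comm a]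
      ring
    have hdist : ‖((t, q t + h, b) - (t, q t, a) : ℝ × E × E)‖ ≤ K' * ‖h‖ := by
      have : (K : ℝ) * ‖h‖ ≤ K' * ‖h‖ := by rw [hK']; nlinarith [norm_nonneg h]
      have h1 : ‖h‖ ≤ K' * ‖h‖ := by
        rw [hK']; nlinarith [norm_nonneg h, mul_nonneg K.coe_nonneg (norm_nonneg h)]
      simp only [Prod.mk_sub_mk, Prod.norm_mk, sub_self, norm_zero, add_sub_cancel_left]
      exact max_le (by positivity) (max_le h1 (hba.trans this))
    have hseg : segment ℝ (t, q t, a) (t, q t + h, b) ⊆ ball (s, q s, p s) ρ :=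
      (convex_ball _ _).segment_subset (hmem0 t ht).2 (hmem t ht h hh).2
    have hmv := (convex_segment (𝕜 := ℝ) (t, q t, a)
        (t, q t + h, b)).norm_image_sub_le_of_norm_hasFDerivWithin_le'
      (f := F) (f' := fderiv ℝ F) (φ := fderiv ℝ F (t, q t, p t))
      (C := L * (M + K' * ‖h‖))
      (fun z _ => ((hF.differentiable (by norm_num)) z).hasFDerivAt.hasFDerivWithinAt)
      (fun z hz => ?_) (left_mem_segment ℝ _ _) (right_mem_segment ℝ _ _)
    · calc _ = ‖F (t, q t + h, b) - F (t, q t, a)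
            - fderiv ℝ F (t, q t, p t) ((t, q t + h, b) - (t, q t, a))‖ := by
            rw [hlin, ← norm_neg]
            congr 1
            simp only [inner_zero_right]
            ring
        _ ≤ _ := hmv.trans (by gcongr)
    · refine (hL.norm_sub_le (hρB (hseg hz)) (hρB (htr t ht))).trans ?_
      gcongr
      have h1 : ‖z - (t, q t, a)‖ ≤ K' * ‖h‖ := by
        refine le_trans ?_ hdist
        rw [← dist_eq_norm, ← dist_eq_norm]
        have := segment_subset_closedBall_left (t, q t, a) (t, q t + h, b) hz
        rw [mem_closedBall] at this
        rwa [dist_comm (t, q t + h, b)]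
      have h2 : ‖((t, q t, a) - (t, q t, p t) : ℝ × E × E)‖ ≤ M := by
        simpa [Prod.norm_mk] using hmax' t ht
      calc _ ≤ ‖z - (t, q t, a)‖ + ‖((t, q t, a) - (t, q t, p t) : ℝ × E × E)‖ :=
            norm_sub_le_norm_sub_add_norm_sub _ _ _
        _ ≤ _ := by linarith
  have hM0 : M = 0 := by
    by_contra hne
    have hMpos : 0 < M := lt_of_le_of_ne (norm_nonneg _) (Ne.symm hne)
    have hderiv : ∀ t ∈ closedBall s δ,
        HasFDerivAt (fun h => ψ h t) (innerSL ℝ (r t)) (0 : E) := by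
      intro t ht
      have hz0 := (hmem0 t ht).1
      have e1 : HasFDerivAt (fun h : E => (t, q t + h))
          ((0 : E →L[ℝ] ℝ).prod (ContinuousLinearMap.id ℝ E)) 0 :=
        (hasFDerivAt_const t (0 : E)).prodMk ((hasFDerivAt_id (0 : E)).const_add (q t))
      have e2 : HasFDerivAt u (fderiv ℝ u (t, q t)) (t, q t + 0) := by
        simpa using (hu _ hz0).hasFDerivAt
      have e3 := ((e2.comp (0 : E) e1).sub_const (u (t, q t))).sub
        ((innerSL ℝ (p t)).hasFDerivAt (x := 0))
      refine e3.congr_fderiv ?_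
      ext ξ
      simp [hP _ hz0, hr]
    have hsm : s ∈ closedBall s δ := mem_closedBall_self hδ.le
    have hg := (hderiv m hm).sub (hderiv s hsm)
    have hrs : r s = 0 := by simp [hr, hs]
    rw [hrs, map_zero, sub_zero] at hg
    have hle : ‖innerSL ℝ (r m)‖ ≤ M / 2 := by
      refine hg.le_of_lip' (by positivity) ?_
      have hev : ∀ᶠ h : E in 𝓝 0, ‖h‖ < min δ₁ (M / K') := by
        have : ball (0 : E) (min δ₁ (M / K')) ∈ 𝓝 0 := ball_mem_nhds _ (by positivity)
        filter_upwards [this] with h hh using by simpa using hh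
      filter_upwards [hev] with h hh
      have hh1 := hh.trans_le (min_le_left _ _)
      have hh2 : K' * ‖h‖ ≤ M := by
        have := (hh.trans_le (min_le_right _ _)).le
        rwa [le_div_iff₀ hK'pos, mul_comm] at this
      choose! c hc hcb using fun t (ht : t ∈ closedBall s δ) => hψ' t ht h hh1
      have hmv := (convex_closedBall s δ).norm_image_sub_le_of_norm_hasDerivWithin_le
        (fun t ht => (hc t ht).hasDerivWithinAt) hcb hsm hm
      have hψ0 : ∀ t, ψ 0 t = 0 := fun t => by simp [hψ]
      have hmd : ‖m - s‖ ≤ δ := by simpa [dist_eq_norm] using hm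
      simp only [hψ0, Pi.sub_apply, sub_zero]
      calc ‖ψ h m - ψ h s‖ ≤ L * (M + K' * ‖h‖) * (K' * ‖h‖) * ‖m - s‖ := hmv
        _ ≤ L * (M + M) * (K' * ‖h‖) * δ := by gcongr
        _ = (2 * (L * K' * δ)) * (M * ‖h‖) := by ring
        _ ≤ (1 / 2) * (M * ‖h‖) := by gcongr
        _ = M / 2 * ‖h‖ := by ring
    rw [innerSL_apply_norm] at hle
    linarith
  filter_upwards [closedBall_mem_nhds s hδ] with t ht
  have := hmax' t ht
  rw [hM0] at this
  exact (sub_eq_zero.1 (norm_le_zero_iff.1 this)).symm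

/-- The gradient of a slice of a differentiable function on a product. -/
theorem inner_gradient_slice {E : Type*} [NormedAddCommGroup E] [InnerProductSpace ℝ E]
    [CompleteSpace E] {u : ℝ × E → ℝ} {z : ℝ × E} (hu : DifferentiableAt ℝ u z) (ξ : E) :
    ⟪gradient (fun y => u (z.1, y)) z.2, ξ⟫ = fderiv ℝ u z (0, ξ) := by
  have h : HasFDerivAt (fun y => u (z.1, y)) _ z.2 :=
    hu.hasFDerivAt.comp z.2 (hasFDerivAt_prodMk_right z.1 z.2)
  rw [gradient, InnerProductSpace.toDual_symm_apply, h.fderiv]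
  simp

/-- The total differential of a solution of the Hamilton–Jacobi equation. -/
theorem fderiv_eq_of_hamiltonJacobi {E : Type*} [NormedAddCommGroup E] [InnerProductSpace ℝ E]
    [CompleteSpace E] {H : ℝ → E → E → ℝ} {u : ℝ × E → ℝ} {z : ℝ × E}
    (hu : DifferentiableAt ℝ u z)
    (hHJ : deriv (fun τ => u (τ, z.2)) z.1
      + H z.1 z.2 (gradient (fun y => u (z.1, y)) z.2) = 0) (τ : ℝ) (ξ : E) :
    fderiv ℝ u z (τ, ξ) = ⟪gradient (fun y => u (z.1, y)) z.2, ξ⟫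
      - τ * H z.1 z.2 (gradient (fun y => u (z.1, y)) z.2) := by
  have h : HasDerivAt (fun τ => u (τ, z.2)) (fderiv ℝ u z (1, 0)) z.1 :=
    hu.hasFDerivAt.comp_hasDerivAt z.1 ((hasDerivAt_id z.1).prodMk (hasDerivAt_const z.1 z.2))
  rw [h.deriv] at hHJ
  have hsplit : ((τ, ξ) : ℝ × E) = (0, ξ) + τ • (1, 0) := by simp
  rw [hsplit, map_add, map_smul, ← inner_gradient_slice hu, smul_eq_mul]
  linear_combination τ * hHJ

/-- A Hamiltonian trajectory which meets the graph of the spatial gradient of a `C^{1,1}_loc`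
solution of the Hamilton–Jacobi equation stays on this graph. -/
theorem hamiltonian_trajectory_mem_graph_gradient {E : Type*} [NormedAddCommGroup E]
    [InnerProductSpace ℝ E] [CompleteSpace E] {H : ℝ → E → E → ℝ}
    (hH : ContDiff ℝ 2 (fun x : ℝ × E × E => H x.1 x.2.1 x.2.2))
    {γ : ℝ → E × E}
    (hγ : ∀ t : ℝ, HasDerivAt γ (gradient (fun p' => H t (γ t).1 p') (γ t).2,
      -gradient (fun q' => H t q' (γ t).2) (γ t).1) t)
    {t₀ t₁ : ℝ} {u : ℝ × E → ℝ}
    (hu_diff : ∀ z : ℝ × E, z.1 ∈ Ioo t₀ t₁ → DifferentiableAt ℝ u z)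
    (hu_lip : ∀ z : ℝ × E, z.1 ∈ Ioo t₀ t₁ →
      ∃ ε > 0, ball z ε ⊆ Ioo t₀ t₁ ×ˢ (univ : Set E) ∧
      ∃ K : ℝ≥0, LipschitzOnWith K (fun w => fderiv ℝ u w) (ball z ε))
    (hu_HJ : ∀ t ∈ Ioo t₀ t₁, ∀ y : E,
      deriv (fun τ => u (τ, y)) t + H t y (gradient (fun y' => u (t, y')) y) = 0)
    {s : ℝ} (hs : s ∈ Ioo t₀ t₁) (hγs : (γ s).2 = gradient (fun y => u (s, y)) (γ s).1)
    {t : ℝ} (ht : t ∈ Ioo t₀ t₁) : (γ t).2 = gradient (fun y => u (t, y)) (γ t).1 := by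
  set F : ℝ × E × E → ℝ := fun x => H x.1 x.2.1 x.2.2 with hFdef
  set P : ℝ × E → E := fun z => gradient (fun y => u (z.1, y)) z.2 with hPdef
  have hFd : ∀ x, DifferentiableAt ℝ F x := hH.differentiable (by norm_num)
  have hγc : Continuous γ := continuous_iff_continuousAt.2 fun t => (hγ t).continuousAt
  have hPlip : ∀ z : ℝ × E, z.1 ∈ Ioo t₀ t₁ → ∃ ε > 0,
      ball z ε ⊆ Ioo t₀ t₁ ×ˢ (univ : Set E) ∧ ∃ K : ℝ≥0, LipschitzOnWith K P (ball z ε) := by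
    intro z hz
    obtain ⟨ε, hε, hsub, K, hK⟩ := hu_lip z hz
    refine ⟨ε, hε, hsub, K, LipschitzOnWith.of_dist_le_mul fun x hx y hy => ?_⟩
    refine le_trans ?_ (hK.dist_le_mul x hx y hy)
    rw [dist_eq_norm, dist_eq_norm, ← innerSL_apply_norm (𝕜 := ℝ)]
    refine ContinuousLinearMap.opNorm_le_bound _
      (norm_nonneg (fderiv ℝ u x - fderiv ℝ u y)) fun ξ => ?_
    rw [innerSL_apply_apply, inner_sub_left, inner_gradient_slice (hu_diff x (hsub hx).1),
      inner_gradient_slice (hu_diff y (hsub hy).1), ← sub_apply]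
    refine (ContinuousLinearMap.le_opNorm _ _).trans ?_
    simp [Prod.norm_mk]
  have hqp : ∀ t ξ, ⟪gradient (fun p' => H t (γ t).1 p') (γ t).2, ξ⟫
        = fderiv ℝ F (t, (γ t).1, (γ t).2) (0, 0, ξ) ∧
      ⟪-gradient (fun q' => H t q' (γ t).2) (γ t).1, ξ⟫
        = -fderiv ℝ F (t, (γ t).1, (γ t).2) (0, ξ, 0) := by
    intro t ξ
    have hx := (hFd (t, (γ t).1, (γ t).2)).hasFDerivAt
    have hp := HasFDerivAt.comp (f := fun p' => (t, (γ t).1, p')) (γ t).2 hx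
      ((hasFDerivAt_const t (γ t).2).prodMk
        ((hasFDerivAt_const (γ t).1 (γ t).2).prodMk (hasFDerivAt_id (γ t).2)))
    have hq := HasFDerivAt.comp (f := fun q' => (t, q', (γ t).2)) (γ t).1 hx
      ((hasFDerivAt_const t (γ t).1).prodMk
        ((hasFDerivAt_id (γ t).1).prodMk (hasFDerivAt_const (γ t).2 (γ t).1)))
    have hp1 : fderiv ℝ (fun p' => H t (γ t).1 p') (γ t).2 = _ := hp.fderiv
    have hq1 : fderiv ℝ (fun q' => H t q' (γ t).2) (γ t).1 = _ := hq.fderiv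
    rw [inner_neg_left, gradient, gradient, InnerProductSpace.toDual_symm_apply,
      InnerProductSpace.toDual_symm_apply, hp1, hq1]
    simp
  have hlocal : ∀ τ ∈ Ioo t₀ t₁, (γ τ).2 = P (τ, (γ τ).1) →
      ∀ᶠ t in nhds τ, (γ t).2 = P (t, (γ t).1) := by
    intro τ hτ hγτ
    obtain ⟨ε, hε, hsub, K, hK⟩ := hPlip (τ, (γ τ).1) hτ
    exact eventually_mem_graph_of_hamiltonian_trajectory (q := fun t => (γ t).1)
      (p := fun t => (γ t).2) hH hε (fun z hz => hu_diff z (hsub hz).1)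
      (fun z hz => fderiv_eq_of_hamiltonJacobi (hu_diff z (hsub hz).1)
        (hu_HJ z.1 (hsub hz).1 z.2))
      hK (fun t => (hγ t).fst) (fun t => (hγ t).snd)
      (fun t ξ => (hqp t ξ).1) (fun t ξ => (hqp t ξ).2) hγτ
  have hPc : ∀ τ ∈ Ioo t₀ t₁, ContinuousAt (fun t => (γ t).2 - P (t, (γ t).1)) τ := by
    intro τ hτ
    obtain ⟨ε, hε, -, K, hK⟩ := hPlip (τ, (γ τ).1) hτ
    have h1 : ContinuousAt P (τ, (γ τ).1) := hK.continuousOn.continuousAt (ball_mem_nhds _ hε)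
    have h2 : ContinuousAt (fun t => P (t, (γ t).1)) τ :=
      ContinuousAt.comp (f := fun t => (t, (γ t).1)) h1 (by fun_prop)
    exact (hγc.snd.continuousAt).sub h2
  have hsub : Ioo t₀ t₁ ⊆ interior {t | (γ t).2 = P (t, (γ t).1)} := by
    refine isPreconnected_Ioo.subset_of_closure_inter_subset isOpen_interior
      ⟨s, hs, mem_interior_iff_mem_nhds.2 (hlocal s hs hγs)⟩ ?_
    rintro τ ⟨hcl, hτ⟩
    refine mem_interior_iff_mem_nhds.2 (hlocal τ hτ (sub_eq_zero.1 ?_))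
    have hfr : ∃ᶠ t in nhds τ, (γ t).2 - P (t, (γ t).1) ∈ ({0} : Set E) :=
      (mem_closure_iff_frequently.1 hcl).mono fun t ht =>
        sub_eq_zero.2 (interior_subset (s := {t | (γ t).2 = P (t, (γ t).1)}) ht)
    exact isClosed_singleton.mem_of_frequently_of_tendsto hfr (hPc τ hτ)
  exact interior_subset (s := {t | (γ t).2 = P (t, (γ t).1)}) (hsub ht)

/-- Uniqueness of `C^{1,1}_loc` solutions of the Cauchy problem for the
Hamilton–Jacobi equation, for a `C²` Hamiltonian with complete Hamiltonian system. -/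
theorem uniqueness_of_C11loc_solutions {d : ℕ}
    (H : ℝ → EuclideanSpace ℝ (Fin d) → EuclideanSpace ℝ (Fin d) → ℝ)
    (hH : ContDiff ℝ 2 (fun x : ℝ × EuclideanSpace ℝ (Fin d) × EuclideanSpace ℝ (Fin d) =>
      H x.1 x.2.1 x.2.2))
    -- completeness: through every point there is a global solution of the Hamiltonian system
    (hcomplete : ∀ (s : ℝ) (x : EuclideanSpace ℝ (Fin d) × EuclideanSpace ℝ (Fin d)),
      ∃ γ : ℝ → EuclideanSpace ℝ (Fin d) × EuclideanSpace ℝ (Fin d),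
        γ s = x ∧ ∀ t : ℝ, HasDerivAt γ
          (gradient (fun p' => H t (γ t).1 p') (γ t).2,
            -gradient (fun q' => H t q' (γ t).2) (γ t).1) t)
    (t₀ t₁ : ℝ) (ht : 0 ∈ Ioo t₀ t₁)
    (u₀ : EuclideanSpace ℝ (Fin d) → ℝ)
    (u v : ℝ × EuclideanSpace ℝ (Fin d) → ℝ)
    -- `u` and `v` are differentiable on `(t₀,t₁) × ℝᵈ` with locally Lipschitz differential
    (hu_diff : ∀ z : ℝ × EuclideanSpace ℝ (Fin d), z.1 ∈ Ioo t₀ t₁ → DifferentiableAt ℝ u z)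
    (hu_lip : ∀ z : ℝ × EuclideanSpace ℝ (Fin d), z.1 ∈ Ioo t₀ t₁ →
      ∃ ε > 0, ball z ε ⊆ Ioo t₀ t₁ ×ˢ (univ : Set (EuclideanSpace ℝ (Fin d))) ∧
      ∃ K : ℝ≥0, LipschitzOnWith K (fun w => fderiv ℝ u w) (ball z ε))
    (hv_diff : ∀ z : ℝ × EuclideanSpace ℝ (Fin d), z.1 ∈ Ioo t₀ t₁ → DifferentiableAt ℝ v z)
    (hv_lip : ∀ z : ℝ × EuclideanSpace ℝ (Fin d), z.1 ∈ Ioo t₀ t₁ →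
      ∃ ε > 0, ball z ε ⊆ Ioo t₀ t₁ ×ˢ (univ : Set (EuclideanSpace ℝ (Fin d))) ∧
      ∃ K : ℝ≥0, LipschitzOnWith K (fun w => fderiv ℝ v w) (ball z ε))
    -- both solve the Hamilton–Jacobi equation
    (hu_HJ : ∀ t ∈ Ioo t₀ t₁, ∀ y : EuclideanSpace ℝ (Fin d),
      deriv (fun τ => u (τ, y)) t + H t y (gradient (fun y' => u (t, y')) y) = 0)
    (hv_HJ : ∀ t ∈ Ioo t₀ t₁, ∀ y : EuclideanSpace ℝ (Fin d),
      deriv (fun τ => v (τ, y)) t + H t y (gradient (fun y' => v (t, y')) y) = 0)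
    -- same initial condition at time 0
    (hu0 : ∀ y, u (0, y) = u₀ y) (hv0 : ∀ y, v (0, y) = u₀ y) :
    ∀ t ∈ Ioo t₀ t₁, ∀ y : EuclideanSpace ℝ (Fin d), u (t, y) = v (t, y) := by
  intro t ht' y
  obtain ⟨γ, hγt, hγ⟩ := hcomplete t (y, gradient (fun y' => u (t, y')) y)
  have hgu : ∀ s ∈ Ioo t₀ t₁, (γ s).2 = gradient (fun y' => u (s, y')) (γ s).1 := fun s hs =>
    hamiltonian_trajectory_mem_graph_gradient hH hγ hu_diff hu_lip hu_HJ ht' (by rw [hγt]) hs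
  have hslice : (fun y' => u (0, y')) = fun y' => v (0, y') := by
    funext y'
    rw [hu0, hv0]
  have hgv : ∀ s ∈ Ioo t₀ t₁, (γ s).2 = gradient (fun y' => v (s, y')) (γ s).1 := fun s hs =>
    hamiltonian_trajectory_mem_graph_gradient hH hγ hv_diff hv_lip hv_HJ ht
      (by rw [hgu 0 ht, hslice]) hs
  have hderiv : ∀ s ∈ Ioo t₀ t₁,
      HasDerivAt (fun s => u (s, (γ s).1) - v (s, (γ s).1)) 0 s := by
    intro s hs
    have hcurve := (hasDerivAt_id s).prodMk (hγ s).fst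
    have du := (hu_diff (s, (γ s).1) hs).hasFDerivAt.comp_hasDerivAt s hcurve
    have dv := (hv_diff (s, (γ s).1) hs).hasFDerivAt.comp_hasDerivAt s hcurve
    refine (du.sub dv).congr_deriv ?_
    rw [fderiv_eq_of_hamiltonJacobi (hu_diff _ hs) (hu_HJ s hs _),
      fderiv_eq_of_hamiltonJacobi (hv_diff _ hs) (hv_HJ s hs _)]
    simp only [← hgu s hs, ← hgv s hs, sub_self]
  have hconst := (convex_Ioo t₀ t₁).norm_image_sub_le_of_norm_hasDerivWithin_le (C := 0)
    (fun s hs => (hderiv s hs).hasDerivWithinAt) (fun s _ => by simp) ht ht'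
  simp only [hu0, hv0, hγt, sub_self, sub_zero, zero_mul] at hconst
  exact sub_eq_zero.1 (norm_le_zero_iff.1 hconst)
end

section
/- Let H(t,q,p) : ℝ × ℝ^d × ℝ^d → ℝ be a C² Hamiltonian such that ‖d²H(t,q,p)‖ ≤ M for all (t,q,p) and ∂²_{pp} H(t,q,p) ≥ m·Id in the sense of quadratic forms for all (t,q,p), with constants 0 < m ≤ M. Let (Q₀^t(q,p), P₀^t(q,p)) denote the value at time t of the solution of the Hamiltonian system (HS) equal to (q,p) at time 0. Then for every t ∈ (0, m/(4M²)], every q ∈ ℝ^d, and every p, p' ∈ ℝ^d, one has ⟨ Q₀^t(q,p') − Q₀^t(q,p), p' − p ⟩ ≥ (m t / 2) |p' − p|². In particular, for each such t and q, the map p ↦ Q₀^t(q,p) is injective. -/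
open scoped RealInnerProductSpace NNReal
open Set Metric

/-- A function whose second derivative is bounded by `M` has an `M`-Lipschitz derivative. -/
theorem norm_fderiv_sub_le_of_norm_iteratedFDeriv_two_le {F : Type*} [NormedAddCommGroup F]
    [NormedSpace ℝ F] {f : F → ℝ} {M : ℝ} (hf : ContDiff ℝ 2 f)
    (hM : ∀ x, ‖iteratedFDeriv ℝ 2 f x‖ ≤ M) (x y : F) :
    ‖fderiv ℝ f y - fderiv ℝ f x‖ ≤ M * ‖y - x‖ := by
  have hdiff : Differentiable ℝ (fderiv ℝ f) :=
    (hf.fderiv_right (m := 1) (by norm_num)).differentiable one_ne_zero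
  refine Convex.norm_image_sub_le_of_norm_fderiv_le (𝕜 := ℝ) (s := univ)
    (fun z _ => hdiff z) (fun z _ => ?_) convex_univ (mem_univ _) (mem_univ _)
  rw [← norm_iteratedFDeriv_one, norm_iteratedFDeriv_fderiv]
  exact hM z

/-- A lower bound on the Hessian makes the gradient strongly monotone. -/
theorem mul_sq_norm_le_inner_gradient_sub {E : Type*} [NormedAddCommGroup E]
    [InnerProductSpace ℝ E] [CompleteSpace E] {g : E → ℝ} {m : ℝ} (hg : ContDiff ℝ 2 g)
    (hm : ∀ p v, m * ‖v‖ ^ 2 ≤ iteratedFDeriv ℝ 2 g p ![v, v]) (p v : E) :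
    m * ‖v‖ ^ 2 ≤ ⟪gradient g (p + v) - gradient g p, v⟫ := by
  have hdiff : Differentiable ℝ (fderiv ℝ g) :=
    (hg.fderiv_right (m := 1) (by norm_num)).differentiable one_ne_zero
  have hderiv (s : ℝ) : HasDerivAt (fun s : ℝ => fderiv ℝ g (p + s • v) v)
      (fderiv ℝ (fderiv ℝ g) (p + s • v) v v) s := by
    have hline : HasDerivAt (fun s : ℝ => p + s • v) v s := by
      simpa using ((hasDerivAt_id s).smul_const v).const_add p
    have := (hdiff (p + s • v)).hasFDerivAt.comp_hasDerivAt s hline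
    simpa using this.clm_apply (hasDerivAt_const s v)
  have hmean := mul_sub_le_image_sub_of_le_deriv (C := m * ‖v‖ ^ 2)
    (fun s => (hderiv s).differentiableAt)
    (fun s => by
      rw [(hderiv s).deriv]
      simpa [iteratedFDeriv_two_apply] using hm (p + s • v) v) zero_le_one
  simpa [gradient, inner_sub_left, InnerProductSpace.toDual_symm_apply] using hmean

/-- Gradients of restrictions of `f` along an affine embedding with contracting linear part
differ by at most the difference of the derivatives of `f`. -/
theorem norm_gradient_sub_le_norm_fderiv_sub {E F : Type*} [NormedAddCommGroup E]
    [InnerProductSpace ℝ E] [CompleteSpace E] [NormedAddCommGroup F] [NormedSpace ℝ F]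
    {f : F → ℝ} (hf : Differentiable ℝ f) {L : E →L[ℝ] F} (hL : ∀ v, ‖L v‖ ≤ ‖v‖)
    {i j : E → F} {a b : E} (hi : HasFDerivAt i L a) (hj : HasFDerivAt j L b) :
    ‖gradient (fun z => f (j z)) b - gradient (fun z => f (i z)) a‖ ≤
      ‖fderiv ℝ f (j b) - fderiv ℝ f (i a)‖ := by
  have ha : fderiv ℝ (fun z => f (i z)) a = (fderiv ℝ f (i a)).comp L :=
    ((hf _).hasFDerivAt.comp a hi).fderiv
  have hb : fderiv ℝ (fun z => f (j z)) b = (fderiv ℝ f (j b)).comp L :=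
    ((hf _).hasFDerivAt.comp b hj).fderiv
  rw [gradient, gradient, ← map_sub, LinearIsometryEquiv.norm_map, ha, hb,
    ← ContinuousLinearMap.sub_comp]
  refine (ContinuousLinearMap.opNorm_comp_le _ _).trans ?_
  refine mul_le_of_le_one_right (norm_nonneg _) ?_
  exact L.opNorm_le_bound zero_le_one (fun v => by simpa using hL v)

/-- If `‖d²H‖ ≤ M`, the gradient of `H` in the last variable is `M`-Lipschitz in phase space. -/
theorem norm_gradient_snd_sub_le {E : Type*} [NormedAddCommGroup E]
    [InnerProductSpace ℝ E] [CompleteSpace E] {H : ℝ → E → E → ℝ} {M : ℝ}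
    (hH : ContDiff ℝ 2 (fun x : ℝ × E × E => H x.1 x.2.1 x.2.2))
    (hM : ∀ x, ‖iteratedFDeriv ℝ 2 (fun y : ℝ × E × E => H y.1 y.2.1 y.2.2) x‖ ≤ M)
    (s : ℝ) (x y : E × E) :
    ‖gradient (fun z => H s y.1 z) y.2 - gradient (fun z => H s x.1 z) x.2‖ ≤
      M * ‖y - x‖ := by
  have hi (x : E × E) : HasFDerivAt (fun z : E => (s, x.1, z))
      ((ContinuousLinearMap.inr ℝ ℝ (E × E)).comp (ContinuousLinearMap.inr ℝ E E)) x.2 :=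
    (hasFDerivAt_prodMk_right s x).comp x.2 (hasFDerivAt_prodMk_right x.1 x.2)
  refine (norm_gradient_sub_le_norm_fderiv_sub (hH.differentiable two_ne_zero) (fun v => ?_)
    (hi x) (hi y)).trans
    ((norm_fderiv_sub_le_of_norm_iteratedFDeriv_two_le hH hM (s, x) (s, y)).trans_eq ?_)
  · simp [Prod.norm_def]
  · simp [Prod.norm_def]

/-- If `‖d²H‖ ≤ M`, the gradient of `H` in the middle variable is `M`-Lipschitz in phase space. -/
theorem norm_gradient_fst_sub_le {E : Type*} [NormedAddCommGroup E]
    [InnerProductSpace ℝ E] [CompleteSpace E] {H : ℝ → E → E → ℝ} {M : ℝ}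
    (hH : ContDiff ℝ 2 (fun x : ℝ × E × E => H x.1 x.2.1 x.2.2))
    (hM : ∀ x, ‖iteratedFDeriv ℝ 2 (fun y : ℝ × E × E => H y.1 y.2.1 y.2.2) x‖ ≤ M)
    (s : ℝ) (x y : E × E) :
    ‖gradient (fun z => H s z y.2) y.1 - gradient (fun z => H s z x.2) x.1‖ ≤
      M * ‖y - x‖ := by
  have hi (x : E × E) : HasFDerivAt (fun z : E => (s, z, x.2))
      ((ContinuousLinearMap.inr ℝ ℝ (E × E)).comp (ContinuousLinearMap.inl ℝ E E)) x.1 :=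
    (hasFDerivAt_prodMk_right s x).comp x.1 (hasFDerivAt_prodMk_left x.1 x.2)
  refine (norm_gradient_sub_le_norm_fderiv_sub (hH.differentiable two_ne_zero) (fun v => ?_)
    (hi x) (hi y)).trans
    ((norm_fderiv_sub_le_of_norm_iteratedFDeriv_two_le hH hM (s, x) (s, y)).trans_eq ?_)
  · simp [Prod.norm_def]
  · simp [Prod.norm_def]

/-- The twist property: under `‖d²H‖ ≤ M` and `∂²ₚₚH ≥ m·Id`, the map
`p ↦ Q₀ᵗ(q, p)` is `(mt/2)`-monotone for `t ∈ (0, m/(4M²)]`; in particular it is injective. -/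
theorem twist_property {d : ℕ}
    (H : ℝ → EuclideanSpace ℝ (Fin d) → EuclideanSpace ℝ (Fin d) → ℝ)
    (hH : ContDiff ℝ 2 (fun x : ℝ × EuclideanSpace ℝ (Fin d) × EuclideanSpace ℝ (Fin d) =>
      H x.1 x.2.1 x.2.2))
    (m M : ℝ) (hm : 0 < m) (hmM : m ≤ M)
    -- Hypothesis 1: `‖d²H‖ ≤ M`
    (hd2H : ∀ x : ℝ × EuclideanSpace ℝ (Fin d) × EuclideanSpace ℝ (Fin d),
      ‖iteratedFDeriv ℝ 2
        (fun y : ℝ × EuclideanSpace ℝ (Fin d) × EuclideanSpace ℝ (Fin d) =>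
          H y.1 y.2.1 y.2.2) x‖ ≤ M)
    -- Hypothesis 2: `∂²ₚₚH ≥ m·Id` in the sense of quadratic forms
    (hconv : ∀ (t : ℝ) (q p v : EuclideanSpace ℝ (Fin d)),
      m * ‖v‖ ^ 2 ≤ iteratedFDeriv ℝ 2 (fun p' => H t q p') p ![v, v])
    -- `φ t` is the (complete) flow of the Hamiltonian system from time `0` to time `t`
    (φ : ℝ → EuclideanSpace ℝ (Fin d) × EuclideanSpace ℝ (Fin d) →
      EuclideanSpace ℝ (Fin d) × EuclideanSpace ℝ (Fin d))
    (hφ_init : ∀ x, φ 0 x = x)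
    (hφ_ode : ∀ x t, HasDerivAt (fun τ => φ τ x)
      (gradient (fun p' => H t (φ t x).1 p') (φ t x).2,
        -gradient (fun q' => H t q' (φ t x).2) (φ t x).1) t) :
    ∀ t : ℝ, 0 < t → t ≤ m / (4 * M ^ 2) →
      ∀ q : EuclideanSpace ℝ (Fin d),
        (∀ p p' : EuclideanSpace ℝ (Fin d),
          m * t / 2 * ‖p' - p‖ ^ 2 ≤ ⟪(φ t (q, p')).1 - (φ t (q, p)).1, p' - p⟫) ∧
        Function.Injective (fun p : EuclideanSpace ℝ (Fin d) => (φ t (q, p)).1) := by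
  intro t ht htM q
  have hM : 0 < M := hm.trans_le hmM
  have hgradp := norm_gradient_snd_sub_le hH hd2H
  have hgradq := norm_gradient_fst_sub_le hH hd2H
  have hmono (p p' : EuclideanSpace ℝ (Fin d)) :
      m * t / 2 * ‖p' - p‖ ^ 2 ≤ ⟪(φ t (q, p')).1 - (φ t (q, p)).1, p' - p⟫ := by
    set v : EuclideanSpace ℝ (Fin d) := p' - p with hv
    let y : ℝ → EuclideanSpace ℝ (Fin d) × EuclideanSpace ℝ (Fin d) :=
      fun s => φ s (q, p') - φ s (q, p) - (0, v)
    have hy (s : ℝ) := ((hφ_ode (q, p') s).fun_sub (hφ_ode (q, p) s)).sub_const (0, v)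
    have hy0 : y 0 = 0 := by simp [y, hφ_init, hv]
    have hgronwall : ∀ s ∈ Icc 0 t, ‖y s‖ ≤ ‖v‖ * (Real.exp (M * s) - 1) := by
      intro s hs
      have h := norm_le_gronwallBound_of_norm_deriv_right_le (f := y) (a := 0) (b := t)
        (δ := 0) (K := M) (ε := M * ‖v‖) (fun u _ => (hy u).continuousAt.continuousWithinAt)
        (fun u _ => (hy u).hasDerivWithinAt) (by simp [hy0]) (fun u _ => ?_) s hs
      · rw [gronwallBound_of_K_ne_0 hM.ne'] at h
        simpa [mul_div_cancel_left₀ _ hM.ne'] using h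
      · have htri : ‖φ u (q, p') - φ u (q, p)‖ ≤ ‖y u‖ + ‖v‖ := by
          have : φ u (q, p') - φ u (q, p) = y u + (0, v) := by simp [y]
          rw [this]
          refine (norm_add_le _ _).trans_eq ?_
          simp [Prod.norm_def]
        have hbound : M * ‖φ u (q, p') - φ u (q, p)‖ ≤ M * ‖y u‖ + M * ‖v‖ := by
          rw [← mul_add]
          gcongr
        refine max_le ((hgradp u _ _).trans hbound) (le_trans (le_of_eq ?_)
          ((hgradq u (φ u (q, p)) (φ u (q, p'))).trans hbound))
        rw [← norm_neg]
        congr 1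
        simp only [Prod.snd_sub]
        abel
    let G : ℝ → EuclideanSpace ℝ (Fin d) := fun s =>
      gradient (fun z => H s (φ s (q, p')).1 z) (φ s (q, p')).2 -
        gradient (fun z => H s (φ s (q, p)).1 z) (φ s (q, p)).2
    have hderiv (s : ℝ) : HasDerivAt (fun s => ⟪(φ s (q, p')).1 - (φ s (q, p)).1, v⟫)
        ⟪G s, v⟫ s := by
      have h := (ContinuousLinearMap.fst ℝ _ _).hasFDerivAt.comp_hasDerivAt s
        ((hφ_ode (q, p') s).fun_sub (hφ_ode (q, p) s))
      simpa [G] using h.inner ℝ (hasDerivAt_const s v)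
    have hlower : ∀ s ∈ Icc 0 t, m / 2 * ‖v‖ ^ 2 ≤ ⟪G s, v⟫ := by
      intro s hs
      set x := φ s (q, p)
      set x' := φ s (q, p')
      have hconvex := mul_sq_norm_le_inner_gradient_sub (g := fun z => H s x.1 z)
        (hH.comp (contDiff_const.prodMk (contDiff_const.prodMk contDiff_id)))
        (hconv s x.1) x.2 v
      have hrem := hgradp s (x.1, x.2 + v) x'
      have hyx : x' - (x.1, x.2 + v) = y s := by
        ext1 <;> simp [y, x, x', sub_sub]
      rw [hyx] at hrem
      have hMs : 4 * M ^ 2 * s ≤ m := by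
        have := (le_div_iff₀ (by positivity)).1 (hs.2.trans htM)
        linarith
      have hMs0 : 0 ≤ M * s := mul_nonneg hM.le hs.1
      have hMs1 : M * s ≤ 1 := by
        by_contra! h
        nlinarith
      have hexp : Real.exp (M * s) - 1 ≤ 2 * (M * s) := by
        have h := Real.abs_exp_sub_one_le (x := M * s) (by rwa [abs_of_nonneg hMs0])
        rw [abs_of_nonneg hMs0] at h
        exact (le_abs_self _).trans h
      have hys : M * ‖y s‖ ≤ m / 2 * ‖v‖ :=
        calc M * ‖y s‖ ≤ M * (‖v‖ * (2 * (M * s))) := by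
              gcongr
              exact (hgronwall s hs).trans (by gcongr)
          _ = (4 * M ^ 2 * s) / 2 * ‖v‖ := by ring
          _ ≤ m / 2 * ‖v‖ := by gcongr
      have hcs := neg_le_of_abs_le ((abs_real_inner_le_norm _ v).trans
        (mul_le_mul_of_nonneg_right (hrem.trans hys) (norm_nonneg v)))
      have hsplit : G s = (gradient (fun z => H s x'.1 z) x'.2 -
          gradient (fun z => H s x.1 z) (x.2 + v)) +
          (gradient (fun z => H s x.1 z) (x.2 + v) - gradient (fun z => H s x.1 z) x.2) := by
        simp [G, x, x']
      rw [hsplit, inner_add_left]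
      linarith
    have hmean := (convex_Icc 0 t).mul_sub_le_image_sub_of_le_deriv
      (fun s _ => (hderiv s).continuousAt.continuousWithinAt)
      (fun s _ => (hderiv s).differentiableAt.differentiableWithinAt)
      (fun s hs => by
        rw [(hderiv s).deriv]
        exact hlower s (interior_subset hs))
      0 (left_mem_Icc.2 ht.le) t (right_mem_Icc.2 ht.le) ht.le
    simp only [hφ_init, sub_self, inner_zero_left, sub_zero] at hmean
    linarith
  refine ⟨hmono, fun p p' hpp => ?_⟩
  have h := hmono p p'
  simp only at hpp
  rw [hpp, sub_self, inner_zero_left] at h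
  have hmt : 0 < m * t / 2 := by positivity
  have hsq : ‖p' - p‖ ^ 2 = 0 := le_antisymm (nonpos_of_mul_nonpos_right h hmt) (sq_nonneg _)
  exact (sub_eq_zero.1 (norm_eq_zero.1 (pow_eq_zero_iff two_ne_zero |>.1 hsq))).symm
end

section
/- Let H(t,q,p) : ℝ × ℝ^d × ℝ^d → ℝ be a C² Hamiltonian such that ∂²_{pp} H(t,q,p) ≥ m·Id in the sense of quadratic forms for all (t,q,p), and such that H(t,q,p) ≤ (M/2)|p|² + M for all (t,q,p), with constants 0 < m ≤ M. Then for all (t,q,p) one has ⟨ p, ∂_p H(t,q,p) ⟩ − H(t,q,p) ≥ (m/M) H(t,q,p) − (m + M). -/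
open scoped RealInnerProductSpace

/-- Second-order Taylor lower bound: if `D²f(z)(v, v) ≥ c` at every point `z`, then
`f (x + v) ≥ f x + Df(x) v + c / 2`. -/
theorem add_fderiv_add_half_le_of_le_iteratedFDeriv_two {E : Type*} [NormedAddCommGroup E]
    [NormedSpace ℝ E] {f : E → ℝ} (hf : ContDiff ℝ 2 f) {v : E} {c : ℝ}
    (hc : ∀ z, c ≤ iteratedFDeriv ℝ 2 f z ![v, v]) (x : E) :
    f x + fderiv ℝ f x v + c / 2 ≤ f (x + v) := by
  have hline (s : ℝ) : HasDerivAt (fun s : ℝ => x + s • v) v s := by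
    simpa using ((hasDerivAt_id s).smul_const v).const_add x
  have hd1 (s : ℝ) : HasDerivAt (fun s : ℝ => f (x + s • v) - c / 2 * s ^ 2)
      (fderiv ℝ f (x + s • v) v - c * s) s := by
    have h1 := ((hf.differentiable (by norm_num)) (x + s • v)).hasFDerivAt.comp_hasDerivAt s
      (hline s)
    have h2 := (hasDerivAt_pow 2 s).const_mul (c / 2)
    refine (h1.sub h2).congr_deriv ?_
    norm_num
    ring
  have hd2 (s : ℝ) : HasDerivAt (fun s : ℝ => fderiv ℝ f (x + s • v) v - c * s)
      (fderiv ℝ (fderiv ℝ f) (x + s • v) v v - c) s := by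
    have hf' : Differentiable ℝ (fderiv ℝ f) :=
      (hf.fderiv_right (m := 1) (by norm_num)).differentiable (by norm_num)
    have h1 : HasDerivAt (fun s : ℝ => fderiv ℝ f (x + s • v))
        (fderiv ℝ (fderiv ℝ f) (x + s • v) v) s :=
      (hf' (x + s • v)).hasFDerivAt.comp_hasDerivAt s (hline s)
    have h2 : HasDerivAt (fun s : ℝ => fderiv ℝ f (x + s • v) v)
        (fderiv ℝ (fderiv ℝ f) (x + s • v) v v) s := by
      simpa using h1.clm_apply (hasDerivAt_const s v)
    exact (h2.sub ((hasDerivAt_id s).const_mul c)).congr_deriv (by simp)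
  have hconvex : ConvexOn ℝ Set.univ (fun s : ℝ => f (x + s • v) - c / 2 * s ^ 2) := by
    refine convexOn_of_hasDerivWithinAt2_nonneg convex_univ
      (fun s _ => (hd1 s).continuousAt.continuousWithinAt)
      (fun s _ => (hd1 s).hasDerivWithinAt) (fun s _ => (hd2 s).hasDerivWithinAt) fun s _ => ?_
    have := hc (x + s • v)
    rw [iteratedFDeriv_two_apply] at this
    simpa using this
  have hslope := hconvex.le_slope_of_hasDerivAt (Set.mem_univ 0) (Set.mem_univ 1) one_pos (hd1 0)
  simp only [zero_smul, add_zero, mul_zero, sub_zero, slope_def_field, one_smul, one_pow, mul_one,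
    ne_eq, OfNat.ofNat_ne_zero, not_false_eq_true, zero_pow, div_one] at hslope
  linarith

/-- If `∂²ₚₚH ≥ m·Id` and `H(t,q,p) ≤ (M/2)|p|² + M`, then
`⟨p, ∂ₚH⟩ - H ≥ (m/M)H - (m + M)`. -/
theorem lower_bound_on_lagrangian {d : ℕ}
    (H : ℝ → EuclideanSpace ℝ (Fin d) → EuclideanSpace ℝ (Fin d) → ℝ)
    (hH : ContDiff ℝ 2 (fun x : ℝ × EuclideanSpace ℝ (Fin d) × EuclideanSpace ℝ (Fin d) =>
      H x.1 x.2.1 x.2.2))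
    (m M : ℝ) (hm : 0 < m) (hmM : m ≤ M)
    -- Hypothesis 2: `∂²ₚₚH ≥ m·Id` in the sense of quadratic forms
    (hconv : ∀ (t : ℝ) (q p v : EuclideanSpace ℝ (Fin d)),
      m * ‖v‖ ^ 2 ≤ iteratedFDeriv ℝ 2 (fun p' => H t q p') p ![v, v])
    -- Hypothesis 3 (upper bound part)
    (hupper : ∀ (t : ℝ) (q p : EuclideanSpace ℝ (Fin d)),
      H t q p ≤ M / 2 * ‖p‖ ^ 2 + M) :
    ∀ (t : ℝ) (q p : EuclideanSpace ℝ (Fin d)),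
      m / M * H t q p - (m + M) ≤
        ⟪p, gradient (fun p' => H t q p') p⟫ - H t q p := by
  intro t q p
  have hM : 0 < M := hm.trans_le hmM
  have hf : ContDiff ℝ 2 (fun p' => H t q p') :=
    hH.comp (contDiff_const.prodMk (contDiff_const.prodMk contDiff_id))
  have htaylor := add_fderiv_add_half_le_of_le_iteratedFDeriv_two hf
    (fun z => hconv t q z (-p)) p
  have hgrad : ⟪p, gradient (fun p' => H t q p') p⟫ = fderiv ℝ (fun p' => H t q p') p p := by
    rw [real_inner_comm, gradient, InnerProductSpace.toDual_symm_apply]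
  have hzero := hupper t q 0
  have hscaled : m / M * H t q p ≤ m / M * (M / 2 * ‖p‖ ^ 2 + M) :=
    mul_le_mul_of_nonneg_left (hupper t q p) (by positivity)
  have hcancel : m / M * (M / 2 * ‖p‖ ^ 2 + M) = m / 2 * ‖p‖ ^ 2 + m := by
    field_simp
  simp only [add_neg_cancel, map_neg, norm_neg] at htaylor
  simp only [norm_zero] at hzero
  rw [hgrad]
  linarith
end

section
/- Let H(t,q,p) : ℝ × ℝ^d × ℝ^d → ℝ be a C² Hamiltonian such that ∂²_{pp} H(t,q,p) ≥ m·Id in the sense of quadratic forms for all (t,q,p), with m > 0. Let Ω ⊂ ℝ × ℝ^d be open and let u(t,q) : Ω → ℝ be a C¹ solution of the Hamilton–Jacobi equation ∂_t u + H(t, q, ∂_q u(t,q)) = 0 on Ω. Let q(t) : [t₀,t₁] → ℝ^d be a C¹ curve such that (t, q(t)) ∈ Ω and q̇(t) = ∂_p H(t, q(t), ∂_q u(t, q(t))) for each t ∈ [t₀,t₁]. Then, setting p(t) = ∂_q u(t, q(t)), the curve t ↦ p(t) is C¹ and (q(t), p(t)) solves the Hamiltonian system (HS) on [t₀,t₁].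 -/
open scoped RealInnerProductSpace
open Set

section HamiltonJacobi

open Filter Topology

variable {E : Type*} [NormedAddCommGroup E] [InnerProductSpace ℝ E]

/-- A `C²` function whose Hessian is at least `m` lies above its tangent paraboloids. -/
lemma add_fderiv_add_sq_le_of_hessian_ge {h : E → ℝ} (hh : ContDiff ℝ 2 h) {m : ℝ}
    (hconv : ∀ p v : E, m * ‖v‖ ^ 2 ≤ iteratedFDeriv ℝ 2 h p ![v, v]) (p r : E) :
    h p + fderiv ℝ h p r + m / 2 * ‖r‖ ^ 2 ≤ h (p + r) := by
  have hline : ∀ s : ℝ, HasDerivAt (fun s : ℝ => p + s • r) r s := fun s => by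
    simpa using ((hasDerivAt_id s).smul_const r).const_add p
  have h1 : ∀ s : ℝ, HasDerivAt (fun s : ℝ => h (p + s • r)) (fderiv ℝ h (p + s • r) r) s :=
    fun s => ((hh.differentiable (by norm_num)) _).hasFDerivAt.comp_hasDerivAt s (hline s)
  have h2 : ∀ s : ℝ, HasDerivAt (fun s : ℝ => fderiv ℝ h (p + s • r) r)
      (fderiv ℝ (fderiv ℝ h) (p + s • r) r r) s := fun s => by
    have hd : ContDiff ℝ 1 (fderiv ℝ h) := hh.fderiv_right (by norm_num)
    exact (((hd.differentiable (by norm_num)) _).hasFDerivAt.comp_hasDerivAt s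
      (hline s)).clm_apply (hasDerivAt_const s r) |>.congr_deriv (by simp)
  set g' : ℝ → ℝ := fun s => fderiv ℝ h (p + s • r) r - fderiv ℝ h p r - m * s * ‖r‖ ^ 2 with hg'
  have hg'd : ∀ s, HasDerivAt g' (fderiv ℝ (fderiv ℝ h) (p + s • r) r r - m * ‖r‖ ^ 2) s :=
    fun s => (((h2 s).sub_const _).sub
      (((hasDerivAt_id s).const_mul m).mul_const (‖r‖ ^ 2))).congr_deriv (by simp)
  have hg'mono : Monotone g' := by
    refine monotone_of_deriv_nonneg (fun s => (hg'd s).differentiableAt) fun s => ?_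
    rw [(hg'd s).deriv]
    have := hconv (p + s • r) r
    rw [iteratedFDeriv_two_apply] at this
    simpa using this
  have hg'0 : g' 0 = 0 := by simp [hg']
  set g : ℝ → ℝ := fun s => h (p + s • r) - s * fderiv ℝ h p r - m / 2 * s ^ 2 * ‖r‖ ^ 2 with hg
  have hgd : ∀ s, HasDerivAt g (g' s) s := fun s =>
    (((h1 s).sub ((hasDerivAt_id s).mul_const (fderiv ℝ h p r))).sub
      ((((hasDerivAt_id s).pow 2).const_mul (m / 2)).mul_const (‖r‖ ^ 2))).congr_deriv (by
        simp only [hg', id, Nat.cast_ofNat, Nat.add_one_sub_one, pow_one]; ring)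
  have hgmono : MonotoneOn g (Ici 0) := by
    refine monotoneOn_of_deriv_nonneg (convex_Ici 0)
      (fun s _ => (hgd s).continuousAt.continuousWithinAt)
      (fun s _ => (hgd s).differentiableAt.differentiableWithinAt) fun s hs => ?_
    rw [(hgd s).deriv, ← hg'0]
    exact hg'mono (interior_subset hs)
  have := hgmono (mem_Ici.2 le_rfl) (mem_Ici.2 zero_le_one) zero_le_one
  simp only [hg] at this
  simp at this
  linarith

/-- Second-order lower bound, locally uniform in the base point, for a `C²` Hamiltonian which is
`m`-convex in the momentum. -/
lemma exists_hamiltonian_lower_bound {F : ℝ × E × E → ℝ} (hF : ContDiff ℝ 2 F) {m : ℝ} (hm : 0 < m)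
    (hconv : ∀ (t : ℝ) (x p v : E),
      m * ‖v‖ ^ 2 ≤ iteratedFDeriv ℝ 2 (fun p' => F (t, x, p')) p ![v, v]) (z₀ : ℝ × E × E) :
    ∃ C ≥ 0, ∃ δ > 0, ∀ z : ℝ × E × E, ‖z - z₀‖ ≤ δ → ∀ k r : E, ‖k‖ ≤ δ →
      F z + fderiv ℝ F z (0, k, r) + m / 4 * ‖r‖ ^ 2 - C * ‖k‖ ^ 2 ≤ F (z + (0, k, r)) := by
  have hd : Differentiable ℝ F := hF.differentiable (by norm_num)
  obtain ⟨K, U, hU, hK⟩ := (hF.fderiv_right (m := 1) (by norm_num)).contDiffAt.exists_lipschitzOnWith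
    (x := z₀)
  obtain ⟨ε, hε, hεU⟩ := Metric.nhds_basis_closedBall.mem_iff.1 hU
  refine ⟨K + (K : ℝ) ^ 2 / m, by positivity, ε / 2, by positivity, fun z hz k r hk => ?_⟩
  have hzU : z ∈ U := hεU (by rw [mem_closedBall_iff_norm]; linarith)
  have hnear : ∀ w ∈ Metric.closedBall z ‖k‖, w ∈ U := fun w hw => hεU (by
    rw [mem_closedBall_iff_norm] at hw ⊢
    calc ‖w - z₀‖ = ‖(w - z) + (z - z₀)‖ := by abel_nf
      _ ≤ _ := norm_add_le _ _
      _ ≤ ε := by linarith)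
  have hlip : ∀ w ∈ Metric.closedBall z ‖k‖, ‖fderiv ℝ F w - fderiv ℝ F z‖ ≤ K * ‖k‖ :=
    fun w hw => by
      have h1 := hK.dist_le_mul w (hnear w hw) z hzU
      rw [dist_eq_norm] at h1
      exact h1.trans (by gcongr; exact hw)
  have hknorm : ‖((0, k, 0) : ℝ × E × E)‖ = ‖k‖ := by simp [Prod.norm_def]
  have hrnorm : ‖((0, 0, r) : ℝ × E × E)‖ = ‖r‖ := by simp [Prod.norm_def]
  set z' : ℝ × E × E := z + (0, k, 0) with hz'
  have hz'mem : z' ∈ Metric.closedBall z ‖k‖ := by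
    rw [mem_closedBall_iff_norm, hz', add_sub_cancel_left, hknorm]
  have hpos := (convex_closedBall z ‖k‖).norm_image_sub_le_of_norm_fderiv_le' (𝕜 := ℝ) (f := F)
    (fun w _ => hd w) hlip (Metric.mem_closedBall_self (norm_nonneg k)) hz'mem
  rw [hz', add_sub_cancel_left, hknorm, ← hz', Real.norm_eq_abs] at hpos
  have hmom : |(fderiv ℝ F z' - fderiv ℝ F z) (0, 0, r)| ≤ K * ‖k‖ * ‖r‖ := by
    rw [← Real.norm_eq_abs, ← hrnorm]
    exact ContinuousLinearMap.le_of_opNorm_le _ (hlip z' hz'mem) _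
  rw [sub_apply] at hmom
  have hstrong : F z' + fderiv ℝ F z' (0, 0, r) + m / 2 * ‖r‖ ^ 2 ≤ F (z + (0, k, r)) := by
    obtain ⟨t, x, p⟩ := z
    have hz'eq : z' = (t, x + k, p) := by simp [hz']
    have hpath : HasFDerivAt (fun p' : E => ((t, x + k, p') : ℝ × E × E))
        ((0 : E →L[ℝ] ℝ).prod ((0 : E →L[ℝ] E).prod (ContinuousLinearMap.id ℝ E))) p :=
      (hasFDerivAt_const t p).prodMk ((hasFDerivAt_const (x + k) p).prodMk (hasFDerivAt_id p))
    have h1 := add_fderiv_add_sq_le_of_hessian_ge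
      (h := fun p' => F (t, x + k, p')) (hF.comp (by fun_prop)) (hconv t (x + k)) p r
    have h2 := ((hd (t, x + k, p)).hasFDerivAt.comp p hpath).fderiv
    change fderiv ℝ (fun p' => F (t, x + k, p')) p = _ at h2
    rw [h2] at h1
    simpa [hz'eq] using h1
  have hsplit : fderiv ℝ F z (0, k, r) = fderiv ℝ F z (0, k, 0) + fderiv ℝ F z (0, 0, r) := by
    rw [← map_add]; simp
  have h1 := (abs_le.1 hpos).1
  have h2 := (abs_le.1 hmom).1
  have h3 : K * ‖k‖ * ‖r‖ ≤ m / 4 * ‖r‖ ^ 2 + (K : ℝ) ^ 2 / m * ‖k‖ ^ 2 := by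
    have : 0 ≤ m / 4 * (‖r‖ - 2 * K * ‖k‖ / m) ^ 2 := by positivity
    have e : m / 4 * (‖r‖ - 2 * K * ‖k‖ / m) ^ 2
      = m / 4 * ‖r‖ ^ 2 + (K : ℝ) ^ 2 / m * ‖k‖ ^ 2 - K * ‖k‖ * ‖r‖ := by
        field_simp; ring
    linarith
  rw [hsplit]
  nlinarith

/-- A function differentiable at `x` whose second differences are quadratically small along a
segment starting at `x` is quadratically close to its tangent. -/
lemma abs_sub_sub_inner_le_of_second_difference {g : E → ℝ} {x k γ : E} {C : ℝ}
    (hg : HasFDerivAt g (innerSL ℝ γ) x)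
    (hC : ∀ s ∈ Icc (0 : ℝ) (1 / 2),
      |g (x + s • k + s • k) + g (x + s • k - s • k) - 2 * g (x + s • k)| ≤ C * ‖s • k‖ ^ 2) :
    |g (x + k) - g x - ⟪γ, k⟫| ≤ C * ‖k‖ ^ 2 := by
  set φ : ℝ → ℝ := fun s => s⁻¹ * (g (x + s • k) - g x) with hφ
  have hstep : ∀ n : ℕ, |φ 1 - φ ((1 / 2) ^ n)| ≤ C * ‖k‖ ^ 2 * (1 - (1 / 2) ^ n) := by
    intro n
    induction n with
    | zero => simp
    | succ n ih =>
      set s : ℝ := (1 / 2) ^ (n + 1) with hs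
      have hs0 : 0 < s := by positivity
      have hs1 : s ≤ 1 / 2 := by
        rw [hs, pow_succ]
        have : ((1 : ℝ) / 2) ^ n ≤ 1 := pow_le_one₀ (by norm_num) (by norm_num)
        linarith
      have hs2 : ((1 : ℝ) / 2) ^ n = 2 * s := by rw [hs, pow_succ]; ring
      have h := hC s ⟨hs0.le, hs1⟩
      rw [add_sub_cancel_right, add_assoc, ← add_smul, ← two_mul, norm_smul, Real.norm_eq_abs,
        abs_of_pos hs0] at h
      have e : φ (2 * s) - φ s
          = (2 * s)⁻¹ * (g (x + (2 * s) • k) + g x - 2 * g (x + s • k)) := by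
        simp only [hφ]; field_simp; ring
      have hb : |φ (2 * s) - φ s| ≤ C * ‖k‖ ^ 2 * s := by
        have hCk : 0 ≤ C * ‖k‖ ^ 2 * s ^ 2 := by
          have := (abs_nonneg _).trans h
          linarith [mul_pow s ‖k‖ 2, this]
        rw [e, abs_mul, abs_of_pos (by positivity : 0 < (2 * s)⁻¹)]
        calc (2 * s)⁻¹ * _ ≤ (2 * s)⁻¹ * (C * (s * ‖k‖) ^ 2) := by gcongr
          _ = C * ‖k‖ ^ 2 * s / 2 := by field_simp
          _ ≤ C * ‖k‖ ^ 2 * s := by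
            have : 0 ≤ C * ‖k‖ ^ 2 * s := by
              by_contra! hneg
              nlinarith
            linarith
      rw [hs2] at ih
      calc |φ 1 - φ s| ≤ |φ 1 - φ (2 * s)| + |φ (2 * s) - φ s| := abs_sub_le _ _ _
        _ ≤ C * ‖k‖ ^ 2 * (1 - s) := by linarith
  have hline : HasDerivAt (fun s : ℝ => g (x + s • k)) ⟪γ, k⟫ 0 := by
    have h0 : HasDerivAt (fun s : ℝ => x + s • k) k 0 := by
      simpa using ((hasDerivAt_id (0 : ℝ)).smul_const k).const_add x
    have h1 : HasFDerivAt g (innerSL ℝ γ) (x + (0 : ℝ) • k) := by simpa using hg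
    exact (h1.comp_hasDerivAt (0 : ℝ) h0).congr_deriv (by simp)
  have hlim : Tendsto (fun n : ℕ => φ ((1 / 2) ^ n)) atTop (𝓝 ⟪γ, k⟫) := by
    have h1 := hline.tendsto_slope_zero
    have h2 : Tendsto (fun n : ℕ => ((1 : ℝ) / 2) ^ n) atTop (𝓝[≠] 0) :=
      tendsto_nhdsWithin_iff.2 ⟨tendsto_pow_atTop_nhds_zero_of_lt_one (by norm_num) (by norm_num),
        Eventually.of_forall fun n => by simp⟩
    refine (h1.comp h2).congr fun n => ?_
    simp [hφ]
  have hCk : 0 ≤ C * ‖k‖ ^ 2 := by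
    have := (abs_nonneg _).trans (hC (1 / 2) ⟨by norm_num, le_rfl⟩)
    rw [norm_smul] at this
    norm_num [mul_pow] at this
    nlinarith
  have hfin : |φ 1 - ⟪γ, k⟫| ≤ C * ‖k‖ ^ 2 :=
    le_of_tendsto (hlim.const_sub _).abs (Eventually.of_forall fun n => (hstep n).trans (by
      have : (0 : ℝ) < (1 / 2) ^ n := by positivity
      nlinarith))
  simpa [hφ] using hfin

/-- Quadratically small second differences force the gradient to be Lipschitz. -/
lemma norm_gradient_sub_le_of_second_difference {g : E → ℝ} {γ : E → E} {x₀ : E} {C ρ : ℝ}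
    (hg : ∀ x, ‖x - x₀‖ ≤ ρ → HasFDerivAt g (innerSL ℝ (γ x)) x)
    (hC : ∀ x k, ‖x - x₀‖ ≤ ρ → ‖k‖ ≤ ρ → |g (x + k) + g (x - k) - 2 * g x| ≤ C * ‖k‖ ^ 2)
    {x y : E} (hx : ‖x - x₀‖ ≤ ρ / 8) (hy : ‖y - x₀‖ ≤ ρ / 8) :
    ‖γ y - γ x‖ ≤ 6 * C * ‖y - x‖ := by
  have hρ : 0 ≤ ρ := by linarith [norm_nonneg (x - x₀)]
  have htaylor : ∀ a k, ‖a - x₀‖ ≤ ρ / 2 → ‖k‖ ≤ ρ / 2 →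
      |g (a + k) - g a - ⟪γ a, k⟫| ≤ C * ‖k‖ ^ 2 := fun a k ha hk =>
    abs_sub_sub_inner_le_of_second_difference (hg a (by linarith)) fun s hs => by
      have hsk : ‖s • k‖ ≤ ρ / 2 := by
        rw [norm_smul, Real.norm_eq_abs, abs_of_nonneg hs.1]
        nlinarith [hs.2, norm_nonneg k]
      refine hC _ _ ?_ (by linarith)
      calc ‖a + s • k - x₀‖ = ‖(a - x₀) + s • k‖ := by abel_nf
        _ ≤ _ := norm_add_le _ _
        _ ≤ ρ := by linarith
  have hyx : ‖y - x‖ ≤ ρ / 4 := by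
    calc ‖y - x‖ = ‖(y - x₀) - (x - x₀)‖ := by abel_nf
      _ ≤ _ := norm_sub_le _ _
      _ ≤ ρ / 4 := by linarith
  rcases (norm_nonneg (y - x)).eq_or_lt with h0 | hpos
  · have : y = x := by rw [← sub_eq_zero, ← norm_eq_zero, h0]
    simp [this]
  rcases (norm_nonneg (γ y - γ x)).eq_or_lt with h0 | hdpos
  · have hC0 : 0 ≤ C := by
      have := (abs_nonneg _).trans (htaylor x (y - x) (by linarith) (by linarith))
      by_contra! hneg
      nlinarith [sq_pos_of_pos hpos]
    rw [← h0]; positivity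
  set R := ‖y - x‖ with hR
  set D := ‖γ y - γ x‖ with hD
  set k : E := (R / D) • (γ y - γ x) with hk
  have hkn : ‖k‖ = R := by
    rw [hk, norm_smul, Real.norm_eq_abs, abs_of_pos (by positivity), ← hD]
    field_simp
  have hyxk : ‖y - x + k‖ ≤ 2 * R := (norm_add_le _ _).trans (by linarith)
  have h1 := htaylor y k (by linarith) (by linarith)
  have h2 := htaylor x (y - x) (by linarith) (by linarith)
  have h3 := htaylor x (y - x + k) (by linarith) (by linarith)
  have hC0 : 0 ≤ C := by
    have := (abs_nonneg _).trans h2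
    by_contra! hneg
    nlinarith [sq_pos_of_pos hpos]
  have h3' : C * ‖y - x + k‖ ^ 2 ≤ C * (2 * R) ^ 2 := by gcongr
  rw [hkn] at h1
  rw [← hR] at h2
  have e1 : x + (y - x) = y := by abel
  have e2 : x + (y - x + k) = y + k := by abel
  rw [e1] at h2
  rw [e2, inner_add_right] at h3
  have hin : ⟪γ y, k⟫ - ⟪γ x, k⟫ = R * D := by
    rw [← inner_sub_left, hk, inner_smul_right, real_inner_self_eq_norm_sq, ← hD]
    field_simp
  have h4 := (abs_le.1 h1).1
  have h4' := (abs_le.1 h1).2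
  have h5 := (abs_le.1 h2).1
  have h6 := (abs_le.1 h3).2
  have h5' := (abs_le.1 h2).2
  have h6' := (abs_le.1 h3).1
  have : R * D ≤ R * (6 * C * R) := by nlinarith
  exact le_of_mul_le_mul_left this hpos

/-- `u` is differentiable at `(t, x)` with spatial gradient `p`, and its time derivative is the one
prescribed by the Hamilton–Jacobi equation. -/
def HasHJDerivAt (H : ℝ → E → E → ℝ) (u : ℝ × E → ℝ) (t : ℝ) (x p : E) : Prop :=
  HasFDerivAt u ((-H t x p) • ContinuousLinearMap.fst ℝ ℝ E +
    (innerSL ℝ p).comp (ContinuousLinearMap.snd ℝ ℝ E)) (t, x)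

lemma HasHJDerivAt.hasDerivAt_comp {H : ℝ → E → E → ℝ} {u : ℝ × E → ℝ} {t : ℝ} {x p : E}
    (hu : HasHJDerivAt H u t x p) {y : ℝ → E} {y' : E} (hy : HasDerivAt y y' t) (hyx : y t = x) :
    HasDerivAt (fun τ => u (τ, y τ)) (-H t x p + ⟪p, y'⟫) t := by
  subst hyx
  have h := HasFDerivAt.comp_hasDerivAt (f := fun τ => (τ, y τ)) t hu ((hasDerivAt_id t).prodMk hy)
  exact h.congr_deriv (by simp)

lemma HasHJDerivAt.hasFDerivAt_space {H : ℝ → E → E → ℝ} {u : ℝ × E → ℝ} {t : ℝ} {x p : E}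
    (hu : HasHJDerivAt H u t x p) : HasFDerivAt (fun y => u (t, y)) (innerSL ℝ p) x := by
  have h := HasFDerivAt.comp x hu ((hasFDerivAt_const t x).prodMk (hasFDerivAt_id x))
  exact h.congr_fderiv (by ext; simp)

lemma not_isMaxOn_of_deriv_neg {g : ℝ → ℝ} {t g' : ℝ} (hg : HasDerivAt g g' t) (hneg : g' < 0)
    (hmax : ∀ᶠ τ in 𝓝[<] t, g τ ≤ g t) : False := by
  have h := hg.hasDerivWithinAt.limsup_slope_le' (s := Iio t) (by simp) hneg
  obtain ⟨τ, h1, h2, h3⟩ := (h.and (hmax.and self_mem_nhdsWithin)).exists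
  rw [slope_def_field, div_neg_iff] at h1
  have h3 : τ < t := h3
  rcases h1 with h1 | h1 <;> linarith [h1.1, h1.2]

/-- A `C¹` solution of the Hamilton–Jacobi equation is semiconcave in space: its second differences
are controlled by a maximum principle, comparing with a barrier moving faster than the
characteristics. -/
lemma second_difference_le [ProperSpace E] {H : ℝ → E → E → ℝ} {Hq Hp : ℝ → E → E → E}
    {u : ℝ × E → ℝ} {G : ℝ × E → E} {t₀ : ℝ} {x₀ p₀ : E} {m C δ L M R T : ℝ}
    (hm : 0 < m) (hC : 0 ≤ C) (hR : 0 < R) (hT : 0 < T) (hLT : L * T ≤ R / 4)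
    (hRδ : 3 * R ≤ δ) (hTδ : 2 * T ≤ δ)
    (hH : ∀ t x p, |t - t₀| ≤ δ → ‖x - x₀‖ ≤ δ → ‖p - p₀‖ ≤ δ → ‖Hp t x p‖ < L ∧
      ∀ k r, ‖k‖ ≤ δ → H t x p + ⟪Hq t x p, k⟫ + ⟪Hp t x p, r⟫ + m / 4 * ‖r‖ ^ 2 - C * ‖k‖ ^ 2
        ≤ H t (x + k) (p + r))
    (hu : ∀ t x, |t - t₀| ≤ 2 * T → ‖x - x₀‖ ≤ 3 * R →
      HasHJDerivAt H u t x (G (t, x)) ∧ |u (t, x)| ≤ M ∧ ‖G (t, x) - p₀‖ ≤ δ)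
    {t₂ : ℝ} {x₂ k₂ : E} (ht₂ : |t₂ - t₀| ≤ T) (hx₂ : ‖x₂ - x₀‖ ≤ R) (hk₂ : ‖k₂‖ ≤ R) :
    u (t₂, x₂ + k₂) + u (t₂, x₂ - k₂) - 2 * u (t₂, x₂) ≤
      (2 * C * T + 2 / (m * T)) * ‖k₂‖ ^ 2 := by
  set c : ℝ := 2 * C * ‖k₂‖ ^ 2 + 2 / m * (‖k₂‖ / T) ^ 2 with hc
  have hcT : (2 * C * T + 2 / (m * T)) * ‖k₂‖ ^ 2 = c * T := by
    rw [hc]; field_simp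
  rw [hcT]
  set t₁ := t₂ - T with ht₁
  set κ : ℝ → E := fun t => ((t - t₁) / T) • k₂ with hκ
  have hκd : ∀ t, HasDerivAt κ ((1 / T) • k₂) t := fun t =>
    (((hasDerivAt_id t).sub_const t₁).div_const T).smul_const k₂
  have hκn : ∀ t ∈ Icc t₁ t₂, ‖κ t‖ ≤ ‖k₂‖ := fun t ht => by
    rw [hκ, norm_smul, Real.norm_eq_abs, abs_of_nonneg (div_nonneg (by linarith [ht.1]) hT.le)]
    exact mul_le_of_le_one_left (norm_nonneg _) ((div_le_one hT).2 (by linarith [ht.2]))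
  have hbox : ∀ t ∈ Icc t₁ t₂, ∀ x, ‖x - x₂‖ ≤ R → |t - t₀| ≤ 2 * T ∧ ‖x - x₀‖ ≤ 3 * R ∧
      ‖x + κ t - x₀‖ ≤ 3 * R ∧ ‖x - κ t - x₀‖ ≤ 3 * R := fun t ht x hx => by
    have h1 := hκn t ht
    have h2 : ‖x - x₀‖ ≤ 2 * R := by
      calc ‖x - x₀‖ = ‖(x - x₂) + (x₂ - x₀)‖ := by abel_nf
        _ ≤ _ := norm_add_le _ _
        _ ≤ 2 * R := by linarith
    refine ⟨?_, by linarith, ?_, ?_⟩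
    · rw [abs_le] at ht₂ ⊢
      constructor <;> linarith [ht.1, ht.2, ht₂.1, ht₂.2]
    · calc ‖x + κ t - x₀‖ = ‖(x - x₀) + κ t‖ := by abel_nf
        _ ≤ _ := norm_add_le _ _
        _ ≤ 3 * R := by linarith
    · calc ‖x - κ t - x₀‖ = ‖(x - x₀) - κ t‖ := by abel_nf
        _ ≤ _ := norm_sub_le _ _
        _ ≤ 3 * R := by linarith
  have key : ∀ A : ℝ, 0 < A → 4 * M ≤ Real.exp (A * (R ^ 2 / 4)) →
      u (t₂, x₂ + k₂) + u (t₂, x₂ - k₂) - 2 * u (t₂, x₂) ≤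
        c * T + Real.exp (A * (-(R ^ 2 / 4))) := by
    intro A hA hAM
    set ψ : ℝ → E → ℝ := fun t x =>
      Real.exp (A * (‖x - x₂‖ ^ 2 + 2 * R * L * (t - t₂) - R ^ 2 / 4)) with hψ
    set Φ : ℝ → E → ℝ := fun t x =>
      u (t, x + κ t) + u (t, x - κ t) - 2 * u (t, x) - c * (t - t₁) - ψ t x with hΦ
    have hΦ₂ : Φ t₂ x₂ = u (t₂, x₂ + k₂) + u (t₂, x₂ - k₂) - 2 * u (t₂, x₂) -
        c * T - Real.exp (A * (-(R ^ 2 / 4))) := by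
      have h1 : κ t₂ = k₂ := by simp [hκ, ht₁, hT.ne']
      have h2 : ψ t₂ x₂ = Real.exp (A * (-(R ^ 2 / 4))) := by simp [hψ]
      simp only [hΦ, h1, h2, ht₁]; ring
    by_contra! hcon
    have hpos : 0 < Φ t₂ x₂ := by rw [hΦ₂]; linarith
    have hcont : ContinuousOn (fun z : ℝ × E => Φ z.1 z.2) (Icc t₁ t₂ ×ˢ Metric.closedBall x₂ R) := by
      rintro ⟨t, x⟩ ⟨ht, hx⟩
      obtain ⟨b0, b1, b2, b3⟩ := hbox t ht x (by simpa [dist_eq_norm] using hx)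
      have hκc : Continuous κ := continuous_iff_continuousAt.2 fun t => (hκd t).continuousAt
      have c1 : ContinuousAt (fun z : ℝ × E => u (z.1, z.2 + κ z.1)) (t, x) :=
        ContinuousAt.comp (f := fun z : ℝ × E => (z.1, z.2 + κ z.1))
          (HasFDerivAt.continuousAt (hu t _ b0 b2).1) (by fun_prop)
      have c2 : ContinuousAt (fun z : ℝ × E => u (z.1, z.2 - κ z.1)) (t, x) :=
        ContinuousAt.comp (f := fun z : ℝ × E => (z.1, z.2 - κ z.1))
          (HasFDerivAt.continuousAt (hu t _ b0 b3).1) (by fun_prop)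
      have c3 : ContinuousAt (fun z : ℝ × E => u (z.1, z.2)) (t, x) :=
        HasFDerivAt.continuousAt (hu t x b0 b1).1
      have c4 : Continuous (fun z : ℝ × E => ψ z.1 z.2) := by fun_prop
      exact ((((c1.add c2).sub (c3.const_mul 2)).sub
        (by fun_prop)).sub c4.continuousAt).continuousWithinAt
    obtain ⟨⟨t, x⟩, ⟨ht, hx⟩, hmax⟩ := (isCompact_Icc.prod (isCompact_closedBall x₂ R)).exists_isMaxOn
      ⟨(t₂, x₂), ⟨by linarith, le_rfl⟩, Metric.mem_closedBall_self hR.le⟩ hcont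
    have hΦpos : 0 < Φ t x := hpos.trans_le
      (hmax (a := (t₂, x₂)) ⟨⟨by linarith, le_rfl⟩, Metric.mem_closedBall_self hR.le⟩)
    replace hx : ‖x - x₂‖ ≤ R := by simpa [dist_eq_norm] using hx
    simp only at ht
    obtain ⟨b0, b1, b2, b3⟩ := hbox t ht x hx
    obtain ⟨d1, m1, g1⟩ := hu t x b0 b1
    obtain ⟨d2, m2, -⟩ := hu t _ b0 b2
    obtain ⟨d3, m3, -⟩ := hu t _ b0 b3
    obtain ⟨hL, hlow⟩ := hH t x (G (t, x)) (b0.trans hTδ) (b1.trans hRδ) g1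
    have hψpos : 0 < ψ t x := Real.exp_pos _
    have hc0 : 0 ≤ c := by positivity
    have htlt : t₁ < t := by
      refine ht.1.lt_of_ne fun heq => ?_
      have : κ t = 0 := by simp [hκ, ← heq]
      have e : c * (t - t₁) = 0 := by rw [heq, sub_self, mul_zero]
      simp only [hΦ, this, e, add_zero, sub_zero] at hΦpos
      linarith
    have hxlt : ‖x - x₂‖ < R := by
      refine hx.lt_of_ne fun heq => ?_
      have : Real.exp (A * (R ^ 2 / 4)) ≤ ψ t x := by
        simp only [hψ, heq]
        gcongr
        have hL0 : 0 ≤ L := (norm_nonneg _).trans hL.le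
        have : R * (L * (t₂ - t)) ≤ R * (R / 4) := by
          gcongr
          exact (mul_le_mul_of_nonneg_left (by linarith) hL0).trans hLT
        linarith
      have h1 := (abs_le.1 m1).1
      have h2 := (abs_le.1 m2).2
      have h3 := (abs_le.1 m3).2
      have h4 : 0 ≤ c * (t - t₁) := mul_nonneg hc0 (by linarith)
      simp only [hΦ] at hΦpos
      linarith
    set w := Hp t x (G (t, x)) with hw
    have hpath : HasDerivAt (fun τ : ℝ => x + (τ - t) • w) w t := by
      simpa using (((hasDerivAt_id t).sub_const t).smul_const w).const_add x
    have hψd : HasDerivAt (fun τ => ψ τ (x + (τ - t) • w))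
        (ψ t x * (A * (2 * ⟪x - x₂, w⟫ + 2 * R * L))) t := by
      have h := (((((hpath.sub_const x₂).norm_sq).add
        (((hasDerivAt_id t).sub_const t₂).const_mul (2 * R * L))).sub_const
          (R ^ 2 / 4)).const_mul A).exp
      refine h.congr_deriv ?_
      simp [hψ]
    have hΦd := ((((d2.hasDerivAt_comp (hpath.add (hκd t)) (by simp)).add
      (d3.hasDerivAt_comp (hpath.sub (hκd t)) (by simp))).sub
      ((d1.hasDerivAt_comp hpath (by simp)).const_mul 2)).sub
      (((hasDerivAt_id t).sub_const t₁).const_mul c)).sub hψd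
    refine not_isMaxOn_of_deriv_neg (g := fun τ => Φ τ (x + (τ - t) • w)) hΦd ?_ ?_
    · have hκδ : ‖κ t‖ ≤ δ := by linarith [hκn t ht]
      set p := G (t, x) with hp
      set pr := G (t, x + κ t) with hpr
      set pl := G (t, x - κ t) with hpl
      have l1 := hlow (κ t) (pr - p) hκδ
      have l2 := hlow (-κ t) (pl - p) (by rwa [norm_neg])
      rw [add_sub_cancel] at l1 l2
      rw [← sub_eq_add_neg, norm_neg] at l2
      simp only [inner_neg_right, inner_add_right, inner_sub_right, inner_smul_right] at l1 l2 ⊢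
      rw [real_inner_comm pr w, real_inner_comm p w] at l1
      rw [real_inner_comm pl w, real_inner_comm p w] at l2
      have hcross : ∀ r : E, 1 / T * ⟪r, k₂⟫ ≤ m / 4 * ‖r‖ ^ 2 + 1 / m * (‖k₂‖ / T) ^ 2 := by
        intro r
        have h1 : 1 / T * ⟪r, k₂⟫ ≤ ‖r‖ * (‖k₂‖ / T) := by
          calc 1 / T * ⟪r, k₂⟫ ≤ 1 / T * (‖r‖ * ‖k₂‖) := by
                gcongr; exact real_inner_le_norm r k₂
            _ = _ := by ring
        have h2 : 0 ≤ m / 4 * (‖r‖ - 2 / m * (‖k₂‖ / T)) ^ 2 := by positivity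
        have h3 : m / 4 * (‖r‖ - 2 / m * (‖k₂‖ / T)) ^ 2 =
            m / 4 * ‖r‖ ^ 2 + 1 / m * (‖k₂‖ / T) ^ 2 - ‖r‖ * (‖k₂‖ / T) := by
          field_simp; ring
        linarith
      have k1 := hcross (pr - p)
      have k2 := hcross (-(pl - p))
      rw [norm_neg] at k2
      simp only [inner_neg_left, inner_sub_left] at k1 k2
      have hbar : 0 < ψ t x * (A * (2 * ⟪x - x₂, w⟫ + 2 * R * L)) := by
        have h1 : -(‖x - x₂‖ * ‖w‖) ≤ ⟪x - x₂, w⟫ :=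
          (abs_le.1 (abs_real_inner_le_norm (x - x₂) w)).1
        have h2 : ‖x - x₂‖ * ‖w‖ < R * L :=
          mul_lt_mul'' hxlt hL (norm_nonneg _) (norm_nonneg _)
        exact mul_pos hψpos (mul_pos hA (by linarith))
      have hκ2 : C * ‖κ t‖ ^ 2 ≤ C * ‖k₂‖ ^ 2 := by
        gcongr; exact hκn t ht
      have hcdef : c = 2 * (C * ‖k₂‖ ^ 2) + 2 * (1 / m * (‖k₂‖ / T) ^ 2) := by rw [hc]; ring
      linarith
    · have e1 : ∀ᶠ τ in 𝓝[<] t, τ ∈ Ioo t₁ t := Ioo_mem_nhdsLT htlt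
      have e2 : ∀ᶠ τ in 𝓝[<] t, ‖x + (τ - t) • w - x₂‖ < R := by
        have hcw : ContinuousAt (fun τ : ℝ => ‖x + (τ - t) • w - x₂‖) t := by fun_prop
        exact (hcw.tendsto.mono_left nhdsWithin_le_nhds).eventually_lt_const (by simpa using hxlt)
      filter_upwards [e1, e2] with τ h1 h2
      have := hmax (a := (τ, x + (τ - t) • w))
        ⟨⟨h1.1.le, h1.2.le.trans ht.2⟩, by rw [mem_closedBall_iff_norm]; exact h2.le⟩
      simpa using this
  have hR4 : 0 < R ^ 2 / 4 := by positivity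
  have hbig : ∀ᶠ A : ℝ in atTop, 4 * M ≤ Real.exp (A * (R ^ 2 / 4)) :=
    (Real.tendsto_exp_atTop.comp (tendsto_id.atTop_mul_const hR4)).eventually_ge_atTop (4 * M)
  have hlim : Tendsto (fun A : ℝ => c * T + Real.exp (A * (-(R ^ 2 / 4)))) atTop
      (𝓝 (c * T + 0)) :=
    (Real.tendsto_exp_atBot.comp
      (tendsto_id.atTop_mul_const_of_neg (neg_lt_zero.2 hR4))).const_add _
  rw [add_zero] at hlim
  exact ge_of_tendsto hlim ((eventually_gt_atTop 0).and hbig |>.mono fun A h => key A h.1 h.2)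

lemma HasHJDerivAt.time_reversal {H : ℝ → E → E → ℝ} {u : ℝ × E → ℝ} {t : ℝ} {x p : E}
    (hu : HasHJDerivAt H u (-t) x p) :
    HasHJDerivAt (fun t x p => H (-t) x (-p)) (fun z => -u (-z.1, z.2)) t x (-p) := by
  have hrev : HasFDerivAt (fun z : ℝ × E => (-z.1, z.2))
      ((-ContinuousLinearMap.fst ℝ ℝ E).prod (ContinuousLinearMap.snd ℝ ℝ E)) (t, x) :=
    hasFDerivAt_fst.neg.prodMk hasFDerivAt_snd
  have h := (HasFDerivAt.comp (f := fun z : ℝ × E => (-z.1, z.2)) (t, x) hu hrev).neg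
  exact h.congr_fderiv (by ext <;> simp)

/-- The spatial gradient of a `C¹` solution of the Hamilton–Jacobi equation is Lipschitz in
space. -/
lemma norm_spatial_gradient_sub_le [ProperSpace E] {H : ℝ → E → E → ℝ} {Hq Hp : ℝ → E → E → E}
    {u : ℝ × E → ℝ} {G : ℝ × E → E} {t₀ : ℝ} {x₀ p₀ : E} {m C δ L M R T : ℝ}
    (hm : 0 < m) (hC : 0 ≤ C) (hR : 0 < R) (hT : 0 < T) (hLT : L * T ≤ R / 4)
    (hRδ : 3 * R ≤ δ) (hTδ : 2 * T ≤ δ)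
    (hH : ∀ t x p, |t - t₀| ≤ δ → ‖x - x₀‖ ≤ δ → ‖p - p₀‖ ≤ δ → ‖Hp t x p‖ < L ∧
      ∀ k r, ‖k‖ ≤ δ → H t x p + ⟪Hq t x p, k⟫ + ⟪Hp t x p, r⟫ + m / 4 * ‖r‖ ^ 2 - C * ‖k‖ ^ 2
        ≤ H t (x + k) (p + r))
    (hu : ∀ t x, |t - t₀| ≤ 2 * T → ‖x - x₀‖ ≤ 3 * R →
      HasHJDerivAt H u t x (G (t, x)) ∧ |u (t, x)| ≤ M ∧ ‖G (t, x) - p₀‖ ≤ δ)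
    {t : ℝ} {x y : E} (ht : |t - t₀| ≤ T) (hx : ‖x - x₀‖ ≤ R / 8) (hy : ‖y - x₀‖ ≤ R / 8) :
    ‖G (t, y) - G (t, x)‖ ≤ 6 * (2 * C * T + 2 / (m * T)) * ‖y - x‖ := by
  have habs : ∀ s, |-s - t₀| = |s - -t₀| := fun s => by rw [← abs_neg]; ring_nf
  have hneg : ∀ p : E, ‖-p - p₀‖ = ‖p - -p₀‖ := fun p => by rw [← norm_neg]; congr 1; abel
  refine norm_gradient_sub_le_of_second_difference (g := fun y => u (t, y))
    (γ := fun y => G (t, y)) (fun a ha => (hu t a (by linarith) (by linarith)).1.hasFDerivAt_space)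
    (fun a k ha hk => abs_le.2 ⟨?_, ?_⟩) hx hy
  · have h := second_difference_le (H := fun t x p => H (-t) x (-p))
      (Hq := fun t x p => Hq (-t) x (-p)) (Hp := fun t x p => -Hp (-t) x (-p))
      (u := fun z => -u (-z.1, z.2)) (G := fun z => -G (-z.1, z.2)) (t₀ := -t₀) (p₀ := -p₀)
      (t₂ := -t) (M := M) hm hC hR hT hLT hRδ hTδ ?_ ?_ (by rw [← habs, neg_neg]; exact ht) ha hk
    · simp only [neg_neg] at h
      linarith
    · intro s b p hs hb hp
      obtain ⟨h1, h2⟩ := hH (-s) b (-p) (by rwa [habs]) hb (by rwa [hneg])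
      refine ⟨by rwa [norm_neg], fun k r hk => ?_⟩
      have := h2 k (-r) hk
      rw [norm_neg, inner_neg_right, ← neg_add] at this
      rwa [inner_neg_left]
    · intro s b hs hb
      obtain ⟨h1, h2, h3⟩ := hu (-s) b (by rwa [habs]) hb
      exact ⟨h1.time_reversal, by rwa [abs_neg], by rwa [← hneg, neg_neg]⟩
  · exact second_difference_le hm hC hR hT hLT hRδ hTδ hH hu ht ha hk

/-- Gradient in the position variable of a function on `ℝ × E × E`. -/
noncomputable def positionGradient [CompleteSpace E] (F : ℝ × E × E → ℝ) (z : ℝ × E × E) : E :=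
  (InnerProductSpace.toDual ℝ E).symm ((fderiv ℝ F z).comp
    ((ContinuousLinearMap.inr ℝ ℝ (E × E)).comp (ContinuousLinearMap.inl ℝ E E)))

/-- Gradient in the momentum variable of a function on `ℝ × E × E`. -/
noncomputable def momentumGradient [CompleteSpace E] (F : ℝ × E × E → ℝ) (z : ℝ × E × E) : E :=
  (InnerProductSpace.toDual ℝ E).symm ((fderiv ℝ F z).comp
    ((ContinuousLinearMap.inr ℝ ℝ (E × E)).comp (ContinuousLinearMap.inr ℝ E E)))

lemma fderiv_apply_eq_inner_add_inner [CompleteSpace E] (F : ℝ × E × E → ℝ) (z : ℝ × E × E)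
    (k r : E) :
    fderiv ℝ F z (0, k, r) = ⟪positionGradient F z, k⟫ + ⟪momentumGradient F z, r⟫ := by
  simp only [positionGradient, momentumGradient, InnerProductSpace.toDual_symm_apply,
    ContinuousLinearMap.comp_apply, ContinuousLinearMap.inl_apply, ContinuousLinearMap.inr_apply]
  rw [← map_add]; simp

lemma continuous_positionGradient [CompleteSpace E] {F : ℝ × E × E → ℝ} (hF : ContDiff ℝ 1 F) :
    Continuous (positionGradient F) :=
  (InnerProductSpace.toDual ℝ E).symm.continuous.comp
    ((hF.continuous_fderiv (by norm_num)).clm_comp continuous_const)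

lemma continuous_momentumGradient [CompleteSpace E] {F : ℝ × E × E → ℝ} (hF : ContDiff ℝ 1 F) :
    Continuous (momentumGradient F) :=
  (InnerProductSpace.toDual ℝ E).symm.continuous.comp
    ((hF.continuous_fderiv (by norm_num)).clm_comp continuous_const)

lemma gradient_position_eq [CompleteSpace E] {F : ℝ × E × E → ℝ} (hF : Differentiable ℝ F)
    (t : ℝ) (x p : E) :
    gradient (fun x' => F (t, x', p)) x = positionGradient F (t, x, p) := by
  have h := HasFDerivAt.comp (f := fun x' => ((t, x', p) : ℝ × E × E)) x
    (hF (t, x, p)).hasFDerivAt ((hasFDerivAt_const t x).prodMk ((hasFDerivAt_id x).prodMk (hasFDerivAt_const p x)))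
  have h' : fderiv ℝ (fun x' => F (t, x', p)) x = _ := h.fderiv
  rw [gradient, positionGradient, h']
  congr 1

lemma gradient_momentum_eq [CompleteSpace E] {F : ℝ × E × E → ℝ} (hF : Differentiable ℝ F)
    (t : ℝ) (x p : E) :
    gradient (fun p' => F (t, x, p')) p = momentumGradient F (t, x, p) := by
  have h := HasFDerivAt.comp (f := fun p' => ((t, x, p') : ℝ × E × E)) p
    (hF (t, x, p)).hasFDerivAt ((hasFDerivAt_const t p).prodMk ((hasFDerivAt_const x p).prodMk (hasFDerivAt_id p)))
  have h' : fderiv ℝ (fun p' => F (t, x, p')) p = _ := h.fderiv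
  rw [gradient, momentumGradient, h']
  congr 1

/-- The spatial gradient of a `C¹` solution of the Hamilton–Jacobi equation is locally Lipschitz in
space. -/
lemma exists_lipschitz_spatial_gradient [ProperSpace E] {F : ℝ × E × E → ℝ}
    (hF : ContDiff ℝ 2 F) {m : ℝ} (hm : 0 < m)
    (hconv : ∀ (t : ℝ) (x p v : E),
      m * ‖v‖ ^ 2 ≤ iteratedFDeriv ℝ 2 (fun p' => F (t, x, p')) p ![v, v])
    {u : ℝ × E → ℝ} {G : ℝ × E → E} {z₀ : ℝ × E}
    (hu : ∀ᶠ z in 𝓝 z₀, HasHJDerivAt (fun t x p => F (t, x, p)) u z.1 z.2 (G z))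
    (hG : ContinuousAt G z₀) :
    ∃ D ≥ 0, ∃ ρ > 0, ∀ t x y, |t - z₀.1| ≤ ρ → ‖x - z₀.2‖ ≤ ρ → ‖y - z₀.2‖ ≤ ρ →
      ‖G (t, y) - G (t, x)‖ ≤ D * ‖y - x‖ := by
  obtain ⟨t₀, x₀⟩ := z₀
  set p₀ := G (t₀, x₀) with hp₀
  obtain ⟨C, hC, δ₁, hδ₁, hlow⟩ := exists_hamiltonian_lower_bound hF hm hconv (t₀, x₀, p₀)
  set L := ‖momentumGradient F (t₀, x₀, p₀)‖ + 1 with hL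
  have hLpos : 0 < L := by positivity
  have hHp : ∀ᶠ z in 𝓝 (t₀, x₀, p₀), ‖momentumGradient F z‖ < L :=
    (continuous_momentumGradient (hF.of_le (by norm_num))).norm.continuousAt.eventually_lt_const
      (by simp [hL])
  obtain ⟨δ₂, hδ₂, hHp⟩ := Metric.nhds_basis_closedBall.mem_iff.1 hHp
  set δ := min δ₁ δ₂ with hδ
  have hδpos : 0 < δ := lt_min hδ₁ hδ₂
  have hubd : ∀ᶠ z in 𝓝 (t₀, x₀), |u z| < |u (t₀, x₀)| + 1 :=
    (HasFDerivAt.continuousAt hu.self_of_nhds).abs.eventually_lt_const (by linarith)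
  have hGbd : ∀ᶠ z in 𝓝 (t₀, x₀), ‖G z - p₀‖ < δ :=
    (hG.sub_const p₀).norm.eventually_lt_const (by simpa [hp₀] using hδpos)
  obtain ⟨ε, hε, hbox⟩ := Metric.nhds_basis_closedBall.mem_iff.1 (hu.and (hubd.and hGbd))
  set R := min ε δ / 3 with hR
  have hmin : 0 < min ε δ := lt_min hε hδpos
  have hRpos : 0 < R := by positivity
  set T := min (min ε δ / 2) (R / (4 * L)) with hT
  have hTpos : 0 < T := lt_min (by positivity) (by positivity)
  have hT1 : 2 * T ≤ min ε δ := by linarith [min_le_left (min ε δ / 2) (R / (4 * L))]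
  have hLT : L * T ≤ R / 4 := by
    calc L * T ≤ L * (R / (4 * L)) := by gcongr; exact min_le_right _ _
      _ = R / 4 := by field_simp
  refine ⟨6 * (2 * C * T + 2 / (m * T)), by positivity, min T (R / 8), by positivity,
    fun t x y ht hx hy => ?_⟩
  refine norm_spatial_gradient_sub_le (H := fun t x p => F (t, x, p))
    (Hq := fun t x p => positionGradient F (t, x, p))
    (Hp := fun t x p => momentumGradient F (t, x, p)) (p₀ := p₀) (δ := δ) (u := u)
    (M := |u (t₀, x₀)| + 1)
    hm hC hRpos hTpos hLT (by linarith [min_le_right ε δ]) (hT1.trans (min_le_right _ _)) ?_ ?_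
    (ht.trans (min_le_left _ _)) (hx.trans (min_le_right _ _)) (hy.trans (min_le_right _ _))
  · intro s a p hs ha hp
    have hz : ‖(s, a, p) - (t₀, x₀, p₀)‖ ≤ δ := by
      simp only [Prod.mk_sub_mk, Prod.norm_def, Real.norm_eq_abs]
      exact max_le hs (max_le ha hp)
    refine ⟨hHp (by rw [mem_closedBall_iff_norm]; exact hz.trans (min_le_right _ _)),
      fun k r hk => ?_⟩
    have h := hlow (s, a, p) (hz.trans (min_le_left _ _)) k r (hk.trans (min_le_left _ _))
    rw [fderiv_apply_eq_inner_add_inner] at h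
    simp only [Prod.mk_add_mk, add_zero] at h
    linarith
  · intro s a hs ha
    have hz : (s, a) ∈ Metric.closedBall (t₀, x₀) ε := by
      rw [mem_closedBall_iff_norm]
      simp only [Prod.mk_sub_mk, Prod.norm_def, Real.norm_eq_abs]
      have := min_le_left ε δ
      exact max_le (by linarith) (by linarith)
    obtain ⟨h1, h2, h3⟩ := hbox hz
    exact ⟨h1, h2.le, h3.le⟩

/-- Along the straight line tangent to a characteristic, the spatial gradient of a `C¹` solution
of the Hamilton–Jacobi equation is differentiable at the base point. -/
lemma hasDerivAt_spatial_gradient_line [CompleteSpace E] {F : ℝ × E × E → ℝ}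
    (hF : ContDiff ℝ 1 F) {u : ℝ × E → ℝ} {G : ℝ × E → E} {t₀ : ℝ} {x₀ v w : E}
    (hv : v = momentumGradient F (t₀, x₀, G (t₀, x₀)))
    (hw : w = positionGradient F (t₀, x₀, G (t₀, x₀)))
    (hu : ∀ᶠ z in 𝓝 (t₀, x₀), HasHJDerivAt (fun t x p => F (t, x, p)) u z.1 z.2 (G z))
    (hG : ContinuousAt G (t₀, x₀)) {D ρ : ℝ} (hD : 0 ≤ D) (hρ : 0 < ρ)
    (hlip : ∀ t x y, |t - t₀| ≤ ρ → ‖x - x₀‖ ≤ ρ → ‖y - x₀‖ ≤ ρ →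
      ‖G (t, y) - G (t, x)‖ ≤ D * ‖y - x‖) :
    HasDerivAt (fun t => G (t, x₀ + (t - t₀) • v)) (-w) t₀ := by
  set Q : ℝ → E := fun t => x₀ + (t - t₀) • v with hQ
  have hQ₀ : Q t₀ = x₀ := by simp [hQ]
  have hQd : ∀ t, HasDerivAt Q v t := fun t => by
    simpa [hQ] using (((hasDerivAt_id t).sub_const t₀).smul_const v).const_add x₀
  have hQc : Continuous Q := continuous_iff_continuousAt.2 fun t => (hQd t).continuousAt
  set a₀ : ℝ × E × E := (t₀, x₀, G (t₀, x₀)) with ha₀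
  rw [hasDerivAt_iff_isLittleO, Asymptotics.isLittleO_iff]
  intro ε hε
  have hstrict := Asymptotics.isLittleO_iff.1
    ((hF.contDiffAt (x := a₀)).hasStrictFDerivAt (by norm_num)).isLittleO
    (div_pos hε (by positivity : 0 < 1 + D))
  have hpt : Tendsto (fun z : ℝ × E => (z.1, Q z.1 + z.2)) (𝓝 (t₀, 0)) (𝓝 (t₀, x₀)) :=
    Continuous.tendsto' (by fun_prop) _ _ (by simp [hQ₀])
  have hpt' : Tendsto (fun z : ℝ × E => (z.1, Q z.1)) (𝓝 (t₀, 0)) (𝓝 (t₀, x₀)) :=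
    Continuous.tendsto' (by fun_prop) _ _ (by simp [hQ₀])
  have hlift : ∀ {f : ℝ × E → ℝ × E}, Tendsto f (𝓝 (t₀, 0)) (𝓝 (t₀, x₀)) →
      Tendsto (fun z => ((f z).1, (f z).2, G (f z))) (𝓝 (t₀, 0)) (𝓝 a₀) := fun {f} hf =>
    ((continuous_fst.tendsto _).comp hf).prodMk_nhds
      (((continuous_snd.tendsto _).comp hf).prodMk_nhds (hG.tendsto.comp hf))
  have hnear : ∀ᶠ z in 𝓝 (t₀, x₀), |z.1 - t₀| ≤ ρ ∧ ‖z.2 - x₀‖ ≤ ρ := by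
    filter_upwards [Metric.closedBall_mem_nhds (t₀, x₀) hρ] with z hz
    rw [mem_closedBall_iff_norm, Prod.norm_def] at hz
    exact ⟨(le_max_left _ _).trans hz, (le_max_right _ _).trans hz⟩
  obtain ⟨η, hη, hbox⟩ := Metric.eventually_nhds_iff_ball.1
    (((hlift hpt).prodMk_nhds (hlift hpt')).eventually hstrict |>.and
      ((hpt.eventually (hu.and hnear)).and (hpt'.eventually (hu.and hnear))))
  have hincr : ∀ t ∈ Metric.ball t₀ η, ∀ k ∈ Metric.ball (0 : E) η,
      ∃ f', HasDerivAt (fun τ => u (τ, Q τ + k) - u (τ, Q τ) + (τ - t₀) * ⟪w, k⟫) f' t ∧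
        ‖f'‖ ≤ ε * ‖k‖ := by
    intro t ht k hk
    obtain ⟨h1, ⟨hu1, hn1⟩, hu2, hn2⟩ := hbox (t, k) (by
      rw [← ball_prod_same]; exact ⟨ht, hk⟩)
    simp only at h1 hu1 hu2 hn1 hn2
    refine ⟨_, ((hu1.hasDerivAt_comp ((hQd t).add_const k) rfl).sub
      (hu2.hasDerivAt_comp (hQd t) rfl)).add
      (((hasDerivAt_id t).sub_const t₀).mul_const ⟪w, k⟫), ?_⟩
    have hr := hlip t (Q t) (Q t + k) hn1.1 hn2.2 hn1.2
    rw [add_sub_cancel_left] at hr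
    set r := G (t, Q t + k) - G (t, Q t) with hrdef
    have hsub : ((t, Q t + k, G (t, Q t + k)) : ℝ × E × E) - (t, Q t, G (t, Q t)) = (0, k, r) := by
      simp [hrdef]
    have hnorm : ‖((0, k, r) : ℝ × E × E)‖ ≤ (1 + D) * ‖k‖ := by
      simp only [Prod.norm_def, norm_zero]
      have := norm_nonneg k
      exact max_le (by positivity) (max_le (by nlinarith) (by nlinarith))
    rw [hsub, fderiv_apply_eq_inner_add_inner, ← hv, ← hw] at h1
    calc _ = ‖F (t, Q t + k, G (t, Q t + k)) - F (t, Q t, G (t, Q t)) - (⟪w, k⟫ + ⟪v, r⟫)‖ := by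
          rw [← norm_neg, hrdef, inner_sub_right, real_inner_comm v, real_inner_comm v]
          congr 1; ring
      _ ≤ ε / (1 + D) * ((1 + D) * ‖k‖) := h1.trans (by gcongr)
      _ = ε * ‖k‖ := by field_simp
  filter_upwards [Metric.ball_mem_nhds t₀ hη] with t ht
  set e : E → ℝ := fun k => u (t, Q t + k) - u (t₀, Q t₀ + k) + (t - t₀) * ⟪w, k⟫ with he
  have hspace : ∀ s ∈ Metric.ball t₀ η,
      HasFDerivAt (fun k => u (s, Q s + k)) (innerSL ℝ (G (s, Q s))) 0 := fun s hs => by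
    obtain ⟨-, -, h, -⟩ := hbox (s, 0) (by
      rw [← ball_prod_same]; exact ⟨hs, Metric.mem_ball_self hη⟩)
    have h2 : HasFDerivAt (fun y => u (s, y)) (innerSL ℝ (G (s, Q s))) (Q s + 0) := by
      simpa using h.hasFDerivAt_space
    exact (h2.comp (0 : E) ((hasFDerivAt_id (0 : E)).const_add (Q s))).congr_fderiv (by ext; simp)
  have hed : HasFDerivAt e (innerSL ℝ (G (t, Q t) - G (t₀, Q t₀) - (t - t₀) • -w)) 0 := by
    refine (((hspace t ht).sub (hspace t₀ (Metric.mem_ball_self hη))).add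
      ((innerSL ℝ w).hasFDerivAt.const_mul (t - t₀))).congr_fderiv ?_
    ext k
    simp
  rw [← innerSL_apply_norm (𝕜 := ℝ)]
  refine hed.le_of_lip' (by positivity) ?_
  filter_upwards [Metric.ball_mem_nhds (0 : E) hη] with k hk
  choose! f' hf' hbd using fun s hs => hincr s hs k hk
  have hmv := Convex.norm_image_sub_le_of_norm_hasDerivWithin_le
    (fun s hs => (hf' s hs).hasDerivWithinAt) hbd (convex_ball t₀ η) (Metric.mem_ball_self hη) ht
  calc ‖e k - e 0‖ = _ := by
        congr 1
        simp only [he, add_zero, inner_zero_right, mul_zero, sub_self, zero_mul]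
        ring
    _ ≤ _ := hmv
    _ = ε * ‖t - t₀‖ * ‖k - 0‖ := by rw [sub_zero]; ring

/-- Characteristics of a `C¹` solution: if `q` has at time `t` the velocity prescribed by the
momentum gradient of the Hamiltonian, then the spatial gradient along `q` satisfies the second
Hamilton equation at time `t`. -/
lemma hasDerivAt_spatial_gradient [ProperSpace E] {F : ℝ × E × E → ℝ}
    (hF : ContDiff ℝ 2 F) {m : ℝ} (hm : 0 < m)
    (hconv : ∀ (t : ℝ) (x p v : E),
      m * ‖v‖ ^ 2 ≤ iteratedFDeriv ℝ 2 (fun p' => F (t, x, p')) p ![v, v])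
    {u : ℝ × E → ℝ} {G : ℝ × E → E} {q : ℝ → E} {t₀ : ℝ}
    (hu : ∀ᶠ z in 𝓝 (t₀, q t₀), HasHJDerivAt (fun t x p => F (t, x, p)) u z.1 z.2 (G z))
    (hG : ContinuousAt G (t₀, q t₀))
    (hq : HasDerivAt q (momentumGradient F (t₀, q t₀, G (t₀, q t₀))) t₀) :
    HasDerivAt (fun t => G (t, q t)) (-positionGradient F (t₀, q t₀, G (t₀, q t₀))) t₀ := by
  obtain ⟨D, hD, ρ, hρ, hlip⟩ := exists_lipschitz_spatial_gradient hF hm hconv hu hG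
  set v := momentumGradient F (t₀, q t₀, G (t₀, q t₀)) with hv
  have hline := hasDerivAt_spatial_gradient_line (hF.of_le (by norm_num)) hv rfl hu hG hD hρ hlip
  set Q : ℝ → E := fun t => q t₀ + (t - t₀) • v with hQ
  have hQ₀ : Q t₀ = q t₀ := by simp [hQ]
  have hQc : Continuous Q := by fun_prop
  have hQq : (fun t => q t - Q t) =o[𝓝 t₀] fun t => t - t₀ :=
    (hasDerivAt_iff_isLittleO.1 hq).congr_left fun t => by simp only [hQ]; abel
  have hball : ∀ {f : ℝ → E}, ContinuousAt f t₀ → f t₀ = q t₀ → ∀ᶠ t in 𝓝 t₀, ‖f t - q t₀‖ ≤ ρ :=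
    fun {f} hf h₀ => ((hf.sub_const (q t₀)).norm.eventually_lt_const
      (by simpa [h₀] using hρ)).mono fun t => le_of_lt
  have hdiff : (fun t => G (t, q t) - G (t, Q t)) =O[𝓝 t₀] fun t => q t - Q t := by
    refine Asymptotics.IsBigO.of_bound D ?_
    filter_upwards [hball hQc.continuousAt hQ₀, hball hq.continuousAt rfl,
      Metric.closedBall_mem_nhds t₀ hρ] with t h1 h2 h3
    exact hlip t (Q t) (q t) h3 h1 h2
  rw [hasDerivAt_iff_isLittleO] at hline ⊢
  refine (hline.add (hdiff.trans_isLittleO hQq)).congr_left fun t => ?_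
  simp only [sub_self, zero_smul, add_zero, hQ]
  abel

lemma gradient_space_eq [CompleteSpace E] {u : ℝ × E → ℝ} {z : ℝ × E}
    (hu : DifferentiableAt ℝ u z) :
    gradient (fun y => u (z.1, y)) z.2 = (InnerProductSpace.toDual ℝ E).symm
      ((fderiv ℝ u z).comp (ContinuousLinearMap.inr ℝ ℝ E)) := by
  have h := HasFDerivAt.comp (f := fun y => (z.1, y)) z.2 hu.hasFDerivAt
    ((hasFDerivAt_const z.1 z.2).prodMk (hasFDerivAt_id z.2))
  have h' : fderiv ℝ (fun y => u (z.1, y)) z.2 = _ := h.fderiv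
  rw [gradient, h']
  congr 1

lemma continuousOn_gradient_space [CompleteSpace E] {u : ℝ × E → ℝ} {Ω : Set (ℝ × E)}
    (hΩ : IsOpen Ω) (hu : ContDiffOn ℝ 1 u Ω) :
    ContinuousOn (fun z => gradient (fun y => u (z.1, y)) z.2) Ω := by
  refine ((InnerProductSpace.toDual ℝ E).symm.continuous.comp_continuousOn
    ((hu.continuousOn_fderiv_of_isOpen hΩ le_rfl).clm_comp continuousOn_const)).congr
    fun z hz => gradient_space_eq ((hu.differentiableOn (by norm_num)).differentiableAt
      (hΩ.mem_nhds hz))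

lemma DifferentiableAt.hasHJDerivAt [CompleteSpace E] {H : ℝ → E → E → ℝ} {u : ℝ × E → ℝ}
    {z : ℝ × E} (hu : DifferentiableAt ℝ u z)
    (hHJ : deriv (fun τ => u (τ, z.2)) z.1 + H z.1 z.2 (gradient (fun y => u (z.1, y)) z.2) = 0) :
    HasHJDerivAt H u z.1 z.2 (gradient (fun y => u (z.1, y)) z.2) := by
  have htime : deriv (fun τ => u (τ, z.2)) z.1 = fderiv ℝ u z (1, 0) :=
    (HasFDerivAt.comp_hasDerivAt (f := fun τ => (τ, z.2)) z.1 hu.hasFDerivAt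
      ((hasDerivAt_id z.1).prodMk (hasDerivAt_const z.1 z.2))).deriv
  rw [← eq_neg_iff_add_eq_zero, htime] at hHJ
  refine hu.hasFDerivAt.congr_fderiv ?_
  rw [eq_neg_iff_add_eq_zero, ← eq_neg_iff_add_eq_zero] at hHJ
  ext
  · simp [hHJ]
  · simp [gradient_space_eq hu]

/-- A curve whose derivative exists on a closed interval and depends continuously on time is `C¹`
there. -/
lemma contDiffOn_one_Icc_of_hasDerivAt {f f' : ℝ → E} {a b : ℝ} (hab : a ≤ b)
    (hf : ∀ t ∈ Icc a b, HasDerivAt f (f' t) t) (hf' : ContinuousOn f' (Icc a b)) :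
    ContDiffOn ℝ 1 f (Icc a b) := by
  rcases hab.eq_or_lt with rfl | hlt
  · intro t ht
    rw [Icc_self] at ht ⊢
    rw [mem_singleton_iff.1 ht]
    exact contDiffWithinAt_singleton
  · rw [show (1 : WithTop ℕ∞) = 0 + 1 by norm_num,
      contDiffOn_succ_iff_derivWithin (uniqueDiffOn_Icc hlt)]
    refine ⟨fun t ht => (hf t ht).differentiableAt.differentiableWithinAt, by simp, ?_⟩
    exact contDiffOn_zero.2 (hf'.congr fun t ht =>
      (hf t ht).hasDerivWithinAt.derivWithin (uniqueDiffOn_Icc hlt t ht))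

end HamiltonJacobi

/-- Under the convexity hypothesis `∂²ₚₚH ≥ m·Id`, if `u` is a `C¹` solution
of the Hamilton–Jacobi equation on an open set `Ω`, and `q(t)` is a `C¹` curve in `Ω`
satisfying `q̇(t) = ∂ₚH(t, q(t), ∂_q u(t, q(t)))`, then `p(t) := ∂_q u(t, q(t))` is `C¹` and
`(q, p)` solves the Hamiltonian system on `[t₀, t₁]`. -/
theorem characteristics_of_C1_solutions {d : ℕ}
    (H : ℝ → EuclideanSpace ℝ (Fin d) → EuclideanSpace ℝ (Fin d) → ℝ)
    (hH : ContDiff ℝ 2 (fun x : ℝ × EuclideanSpace ℝ (Fin d) × EuclideanSpace ℝ (Fin d) =>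
      H x.1 x.2.1 x.2.2))
    (m : ℝ) (hm : 0 < m)
    -- Hypothesis 2: `∂²ₚₚH ≥ m·Id` in the sense of quadratic forms
    (hconv : ∀ (t : ℝ) (q p v : EuclideanSpace ℝ (Fin d)),
      m * ‖v‖ ^ 2 ≤ iteratedFDeriv ℝ 2 (fun p' => H t q p') p ![v, v])
    (Ω : Set (ℝ × EuclideanSpace ℝ (Fin d))) (hΩ : IsOpen Ω)
    (u : ℝ × EuclideanSpace ℝ (Fin d) → ℝ)
    -- `u` is `C¹` on `Ω`
    (hu_C1 : ContDiffOn ℝ 1 u Ω)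
    -- `u` solves the Hamilton–Jacobi equation on `Ω`
    (hu_HJ : ∀ z ∈ Ω, deriv (fun τ => u (τ, z.2)) z.1 +
      H z.1 z.2 (gradient (fun y => u (z.1, y)) z.2) = 0)
    (t₀ t₁ : ℝ) (ht : t₀ ≤ t₁)
    (q : ℝ → EuclideanSpace ℝ (Fin d))
    (hq_mem : ∀ t ∈ Icc t₀ t₁, (t, q t) ∈ Ω)
    (hq_ode : ∀ t ∈ Icc t₀ t₁,
      HasDerivAt q
        (gradient (fun p' => H t (q t) p') (gradient (fun y => u (t, y)) (q t))) t) :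
    ContDiffOn ℝ 1 (fun t => gradient (fun y => u (t, y)) (q t)) (Icc t₀ t₁) ∧
    ∀ t ∈ Icc t₀ t₁,
      HasDerivAt q
        (gradient (fun p' => H t (q t) p')
          (gradient (fun y => u (t, y)) (q t))) t ∧
      HasDerivAt (fun τ => gradient (fun y => u (τ, y)) (q τ))
        (-gradient (fun q' => H t q' (gradient (fun y => u (t, y)) (q t))) (q t)) t := by
  set F : ℝ × EuclideanSpace ℝ (Fin d) × EuclideanSpace ℝ (Fin d) → ℝ :=
    fun x => H x.1 x.2.1 x.2.2 with hF
  set G : ℝ × EuclideanSpace ℝ (Fin d) → EuclideanSpace ℝ (Fin d) :=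
    fun z => gradient (fun y => u (z.1, y)) z.2 with hG
  have hFd : Differentiable ℝ F := hH.differentiable (by norm_num)
  have hF1 : ContDiff ℝ 1 F := hH.of_le (by norm_num)
  have hGc : ContinuousOn G Ω := continuousOn_gradient_space hΩ hu_C1
  have hHJ : ∀ z ∈ Ω, HasHJDerivAt H u z.1 z.2 (G z) := fun z hz =>
    ((hu_C1.differentiableOn (by norm_num)).differentiableAt (hΩ.mem_nhds hz)).hasHJDerivAt
      (hu_HJ z hz)
  have hq : ∀ t ∈ Icc t₀ t₁, HasDerivAt q (momentumGradient F (t, q t, G (t, q t))) t :=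
    fun t ht => (hq_ode t ht).congr_deriv (gradient_momentum_eq hFd t (q t) (G (t, q t)))
  have hp : ∀ t ∈ Icc t₀ t₁, HasDerivAt (fun τ => G (τ, q τ))
      (-positionGradient F (t, q t, G (t, q t))) t := fun t ht => by
    have hnhds := hΩ.mem_nhds (hq_mem t ht)
    exact hasDerivAt_spatial_gradient hH hm hconv (Filter.eventually_of_mem hnhds hHJ)
      (hGc.continuousAt hnhds) (hq t ht)
  refine ⟨contDiffOn_one_Icc_of_hasDerivAt ht hp ?_, fun t ht => ⟨hq_ode t ht, ?_⟩⟩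
  · have hqc : ContinuousOn q (Icc t₀ t₁) := fun t ht =>
      (hq t ht).continuousAt.continuousWithinAt
    have hpc : ContinuousOn (fun τ => G (τ, q τ)) (Icc t₀ t₁) := fun t ht =>
      (hp t ht).continuousAt.continuousWithinAt
    exact ((continuous_positionGradient hF1).comp_continuousOn
      (continuousOn_id.prodMk (hqc.prodMk hpc))).neg
  · exact (hp t ht).congr_deriv
      (congrArg Neg.neg (gradient_position_eq hFd t (q t) (G (t, q t))).symm)
end
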